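/- arXiv:math/0610455 — 8 statements merged into one kernel-verified Lean document; each statement's English description precedes it below -/
import Mathlib

section
/- Let c = ℝ≥0 v₁ + … + ℝ≥0 vₖ be a pointed rational polyhedral cone in ℝ^d (i.e. v₁,…,vₖ ∈ ℤ^d and c ∩ (−c) = {0}). Let ξ ∈ ℝ^d satisfy ⟨ξ,x⟩ < 0 for every x ∈ c \ {0}. Then the family (e^{⟨ξ,x⟩})_{x ∈ c ∩ ℤ^d} is summable. -/
open scoped RealInnerProductSpace

lemma cone_aux_int (ε : ℝ) (hε : 0 < ε) : Summable (fun n : ℤ => Real.exp (-ε * |(n : ℝ)|)) := by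
  have h : Summable (fun n : ℕ => Real.exp (-ε * (n : ℝ))) := by
    have := Real.summable_exp_nat_mul_iff.mpr (neg_lt_zero.mpr hε)
    refine this.congr fun n => by ring_nf
  refine Summable.of_nat_of_neg ?_ ?_
  · simpa using h
  · simpa using h

lemma cone_aux_pi (f : ℤ → ℝ) (hf : Summable f) (h0 : ∀ n, 0 ≤ f n) (d : ℕ) :
    Summable (fun x : Fin d → ℤ => ∏ j, f (x j)) := by
  induction d with
  | zero => exact Summable.of_finite
  | succ d ih =>
    rw [← (Fin.consEquiv (fun _ : Fin (d+1) => ℤ)).summable_iff]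
    have := hf.mul_of_nonneg ih h0 (fun x => Finset.prod_nonneg fun j _ => h0 _)
    refine this.congr fun p => ?_
    simp [Fin.prod_univ_succ, Fin.consEquiv]

/-- For a pointed rational polyhedral cone `c` in `ℝ^d` and `ξ` with
`⟨ξ, x⟩ < 0` for all nonzero `x ∈ c`, the family `(e^{⟨ξ,x⟩})_{x ∈ c ∩ ℤ^d}` is summable. -/
theorem cone_exp_summable
    (d k : ℕ) (v : Fin k → EuclideanSpace ℝ (Fin d))
    (hv : ∀ i, ∀ j, ∃ n : ℤ, v i j = (n : ℝ))
    (c : Set (EuclideanSpace ℝ (Fin d)))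
    (hc : c = {x | ∃ t : Fin k → ℝ, (∀ i, 0 ≤ t i) ∧ x = ∑ i, t i • v i})
    (hpointed : c ∩ (-c) = {0})
    (ξ : EuclideanSpace ℝ (Fin d))
    (hξ : ∀ x ∈ c, x ≠ 0 → ⟪ξ, x⟫ < 0) :
    Summable (fun x : {x : EuclideanSpace ℝ (Fin d) // x ∈ c ∧ ∀ j, ∃ n : ℤ, x j = (n : ℝ)} =>
      Real.exp ⟪ξ, (x : EuclideanSpace ℝ (Fin d))⟫) := by
  have hvc : ∀ i, v i ∈ c := by
    intro i
    rw [hc]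
    refine ⟨Pi.single i 1, fun j => ?_, ?_⟩
    · by_cases h : j = i
      · subst h; simp
      · simp [h]
    · simp [Pi.single_apply]
  have hle : ∀ i, 0 ≤ -⟪ξ, v i⟫ := by
    intro i
    by_cases h : v i = 0
    · simp [h]
    · linarith [hξ _ (hvc i) h]
  have hS : ∀ x : EuclideanSpace ℝ (Fin d), 0 ≤ ∑ j, |x j| :=
    fun x => Finset.sum_nonneg fun j _ => abs_nonneg _
  obtain ⟨C, hC, hCv⟩ : ∃ C : ℝ, 0 < C ∧ ∀ i, ∑ j, |v i j| ≤ C * (-⟪ξ, v i⟫) := by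
    have hn : ∀ i ∈ Finset.univ, 0 ≤ (∑ j, |v i j|) / (-⟪ξ, v i⟫) :=
      fun i _ => div_nonneg (hS _) (hle i)
    refine ⟨1 + ∑ i, (∑ j, |v i j|) / (-⟪ξ, v i⟫), ?_, ?_⟩
    · linarith [Finset.sum_nonneg hn]
    · intro i
      by_cases h : v i = 0
      · simp [h]
      · have h1 : 0 < -⟪ξ, v i⟫ := by linarith [hξ _ (hvc i) h]
        rw [← div_le_iff₀ h1]
        linarith [Finset.single_le_sum hn (Finset.mem_univ i)]
  have hbound : ∀ x ∈ c, ∑ j, |x j| ≤ C * (-⟪ξ, x⟫) := by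
    intro x hx
    rw [hc] at hx
    obtain ⟨t, ht, rfl⟩ := hx
    calc ∑ j, |(∑ i, t i • v i) j| ≤ ∑ j, ∑ i, t i * |v i j| := by
          refine Finset.sum_le_sum fun j _ => ?_
          have : (∑ i, t i • v i) j = ∑ i, t i * v i j := by simp
          rw [this]
          refine (Finset.abs_sum_le_sum_abs _ _).trans (le_of_eq ?_)
          refine Finset.sum_congr rfl fun i _ => ?_
          rw [abs_mul, abs_of_nonneg (ht i)]
      _ = ∑ i, t i * ∑ j, |v i j| := by
          rw [Finset.sum_comm]; simp [Finset.mul_sum]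
      _ ≤ ∑ i, t i * (C * (-⟪ξ, v i⟫)) :=
          Finset.sum_le_sum fun i _ => mul_le_mul_of_nonneg_left (hCv i) (ht i)
      _ = C * (-⟪ξ, ∑ i, t i • v i⟫) := by
          rw [inner_sum, ← Finset.sum_neg_distrib, Finset.mul_sum]
          refine Finset.sum_congr rfl fun i _ => ?_
          rw [inner_smul_right]; ring
  have hsum := cone_aux_pi _ (cone_aux_int C⁻¹ (inv_pos.mpr hC)) (fun n => (Real.exp_pos _).le) d
  choose g hg using fun x : {x : EuclideanSpace ℝ (Fin d) // x ∈ c ∧ ∀ j, ∃ n : ℤ, x j = (n : ℝ)} =>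
    x.2.2
  choose g hg using fun x : {x : EuclideanSpace ℝ (Fin d) // x ∈ c ∧ ∀ j, ∃ n : ℤ, x j = (n : ℝ)} =>
    (⟨g x, hg x⟩ : ∃ n : Fin d → ℤ, ∀ j, x.1 j = (n j : ℝ))
  have hinj : Function.Injective g := by
    intro x y h
    ext j
    rw [hg, hg, h]
  refine Summable.of_nonneg_of_le (fun x => (Real.exp_pos _).le) (fun x => ?_)
    (hsum.comp_injective hinj)
  have hb := hbound x.1 x.2.1
  simp only [Function.comp, ← Real.exp_sum]
  apply Real.exp_le_exp.mpr
  rw [← Finset.mul_sum]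
  simp only [← hg]
  have := mul_le_mul_of_nonneg_left hb (inv_pos.mpr hC).le
  rw [← mul_assoc, inv_mul_cancel₀ hC.ne'] at this
  linarith
end

section
/- Let v₁,…,v_d be linearly independent vectors in ℤ^d, let c = ℝ≥0 v₁ + … + ℝ≥0 v_d and let □(c) = {t₁v₁ + … + t_d v_d : 0 ≤ tᵢ < 1}. For every ξ ∈ ℝ^d with ⟨ξ,vᵢ⟩ < 0 for all i, one has Σ_{x ∈ c ∩ ℤ^d} e^{⟨ξ,x⟩} = (Σ_{x ∈ □(c) ∩ ℤ^d} e^{⟨ξ,x⟩}) · ∏_{i=1}^{d} 1/(1 − e^{⟨ξ,vᵢ⟩}), where the left-hand side is a convergent sum and the inner sum on the right is finite. -/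
open scoped RealInnerProductSpace

theorem summable_mul_aux {α β : Type*} {f : α → ℝ} {g : β → ℝ} (hf : Summable f)
    (hg : Summable g) (hf0 : ∀ a, 0 ≤ f a) (hg0 : ∀ b, 0 ≤ g b) :
    Summable (fun x : α × β => f x.1 * g x.2) :=
  hf.mul_of_nonneg hg (Pi.le_def.2 hf0) (Pi.le_def.2 hg0)

theorem hasSum_geom_pi (d : ℕ) (r : Fin d → ℝ) (h0 : ∀ i, 0 ≤ r i) (h1 : ∀ i, r i < 1) :
    HasSum (fun n : Fin d → ℕ => ∏ i, r i ^ n i) (∏ i, (1 - r i)⁻¹) := by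
  induction d with
  | zero =>
    simp only [Finset.univ_eq_empty, Finset.prod_empty]
    exact hasSum_unique (fun _ : Fin 0 → ℕ => (1 : ℝ))
  | succ d ih =>
    have hg := hasSum_geometric_of_lt_one (h0 0) (h1 0)
    have ht := ih (fun i => r i.succ) (fun i => h0 _) (fun i => h1 _)
    have hs : Summable (fun x : ℕ × (Fin d → ℕ) => r 0 ^ x.1 * ∏ i, r i.succ ^ x.2 i) :=
      summable_mul_aux (f := fun n : ℕ => r 0 ^ n)
        (g := fun n : Fin d → ℕ => ∏ i, r i.succ ^ n i) hg.summable ht.summable (fun n => pow_nonneg (h0 0) n)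
        (fun n => Finset.prod_nonneg fun i _ => pow_nonneg (h0 _) _)
    have := hg.mul ht hs
    rw [Fin.prod_univ_succ, ← (Fin.consEquiv (fun _ => ℕ)).hasSum_iff]
    have hfe : (fun n : Fin (d + 1) → ℕ => ∏ i, r i ^ n i) ∘ (Fin.consEquiv (fun _ => ℕ)) =
        fun x : ℕ × (Fin d → ℕ) => r 0 ^ x.1 * ∏ i, r i.succ ^ x.2 i := by
      funext x
      simp [Fin.prod_univ_succ, Fin.consEquiv]
    rw [hfe]
    exact this

set_option maxHeartbeats 2000000 in
/-- for a full-dimensional simplicial cone `c` generated by linearly independent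
lattice vectors `v₁, …, v_d` and `ξ` with `⟨ξ, vᵢ⟩ < 0`, the sum `S(c)(ξ)` converges and equals
the (finite) sum over the lattice points of the semi-open parallelepiped times
`∏ᵢ 1/(1 - e^{⟨ξ,vᵢ⟩})`. -/
theorem cone_exp_sum_eq_parallelepiped_sum_mul_prod
    (d : ℕ) (v : Fin d → EuclideanSpace ℝ (Fin d))
    (hv : ∀ i, ∀ j, ∃ m : ℤ, v i j = (m : ℝ))
    (hindep : LinearIndependent ℝ v)
    (c Box : Set (EuclideanSpace ℝ (Fin d)))
    (hc : c = {x | ∃ t : Fin d → ℝ, (∀ i, 0 ≤ t i) ∧ x = ∑ i, t i • v i})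
    (hBox : Box = {x | ∃ t : Fin d → ℝ, (∀ i, 0 ≤ t i ∧ t i < 1) ∧ x = ∑ i, t i • v i})
    (ξ : EuclideanSpace ℝ (Fin d))
    (hξ : ∀ i, ⟪ξ, v i⟫ < 0) :
    Summable (fun x : {x : EuclideanSpace ℝ (Fin d) // x ∈ c ∧ ∀ j, ∃ m : ℤ, x j = (m : ℝ)} =>
      Real.exp ⟪ξ, (x : EuclideanSpace ℝ (Fin d))⟫) ∧
    {x ∈ Box | ∀ j, ∃ m : ℤ, x j = (m : ℝ)}.Finite ∧
    (∑' x : {x : EuclideanSpace ℝ (Fin d) // x ∈ c ∧ ∀ j, ∃ m : ℤ, x j = (m : ℝ)},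
        Real.exp ⟪ξ, (x : EuclideanSpace ℝ (Fin d))⟫) =
      (∑' y : {y : EuclideanSpace ℝ (Fin d) // y ∈ Box ∧ ∀ j, ∃ m : ℤ, y j = (m : ℝ)},
        Real.exp ⟪ξ, (y : EuclideanSpace ℝ (Fin d))⟫) *
      ∏ i, 1 / (1 - Real.exp ⟪ξ, v i⟫) := by
  subst hc hBox
  have hfin : {x ∈ {x | ∃ t : Fin d → ℝ, (∀ i, 0 ≤ t i ∧ t i < 1) ∧ x = ∑ i, t i • v i} |
      ∀ j, ∃ m : ℤ, x j = (m : ℝ)}.Finite := by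
    let M : Fin d → ℤ := fun j => ⌈∑ i, |v i j|⌉
    refine ((Set.finite_Icc (-M) M).image
      (fun m : Fin d → ℤ => (WithLp.toLp 2 (fun j => (m j : ℝ)) : EuclideanSpace ℝ (Fin d)))).subset ?_
    rintro x ⟨⟨t, ht, hx⟩, hm⟩
    choose m hm using hm
    have hb : ∀ j, |(m j : ℝ)| ≤ M j := by
      intro j
      refine le_trans ?_ (Int.le_ceil _)
      rw [← hm j, hx]
      simp only [WithLp.ofLp_sum, WithLp.ofLp_smul, Finset.sum_apply, Pi.smul_apply, smul_eq_mul]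
      refine (Finset.abs_sum_le_sum_abs _ _).trans (Finset.sum_le_sum fun i _ => ?_)
      rw [abs_mul, abs_of_nonneg (ht i).1]
      exact mul_le_of_le_one_left (abs_nonneg _) (ht i).2.le
    refine ⟨m, ⟨fun j => ?_, fun j => ?_⟩, ?_⟩
    · have := (abs_le.1 (hb j)).1
      exact_mod_cast this
    · have := (abs_le.1 (hb j)).2
      exact_mod_cast this
    · ext j
      simp [hm j]
  set C := {x : EuclideanSpace ℝ (Fin d) // x ∈ {x | ∃ t : Fin d → ℝ, (∀ i, 0 ≤ t i) ∧
    x = ∑ i, t i • v i} ∧ ∀ j, ∃ m : ℤ, x j = (m : ℝ)} with hC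
  set B := {y : EuclideanSpace ℝ (Fin d) // y ∈ {x | ∃ t : Fin d → ℝ, (∀ i, 0 ≤ t i ∧ t i < 1) ∧
    x = ∑ i, t i • v i} ∧ ∀ j, ∃ m : ℤ, y j = (m : ℝ)} with hB
  have hBf : Finite B := hfin.to_subtype
  choose w hw using hv
  have huniq : ∀ s t : Fin d → ℝ, ∑ i, s i • v i = ∑ i, t i • v i → s = t := by
    intro s t h
    have h2 : ∑ i, (s i - t i) • v i = 0 := by
      simp [sub_smul, Finset.sum_sub_distrib, h]
    funext i
    have := Fintype.linearIndependent_iff.1 hindep _ h2 i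
    linarith
  let f : B × (Fin d → ℕ) → C := fun p => ⟨p.1.1 + ∑ i, (p.2 i : ℝ) • v i, by
    obtain ⟨⟨y, ⟨t, ht, hy⟩, hm⟩, n⟩ := p
    refine ⟨⟨fun i => t i + n i, fun i => add_nonneg (ht i).1 (Nat.cast_nonneg _), ?_⟩, fun j => ?_⟩
    · simp [hy, add_smul, Finset.sum_add_distrib]
    · obtain ⟨m, hm⟩ := hm j
      refine ⟨m + ∑ i, n i * w i j, ?_⟩
      simp [hm, hw]⟩
  have hinj : Function.Injective f := by
    rintro ⟨⟨y, ⟨t, ht, hy⟩, hm⟩, n⟩ ⟨⟨y', ⟨t', ht', hy'⟩, hm'⟩, n'⟩ h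
    have h1 : y + ∑ i, (n i : ℝ) • v i = y' + ∑ i, (n' i : ℝ) • v i := congrArg Subtype.val h
    have h2 := huniq (fun i => t i + n i) (fun i => t' i + n' i) (by
      simpa [hy, hy', add_smul, Finset.sum_add_distrib] using h1)
    have h3 : n = n' := by
      funext i
      have h4 : t i + n i = t' i + n' i := congrFun h2 i
      have a := ht i
      have b := ht' i
      have h5 : (n i : ℝ) < n' i + 1 := by linarith
      have h6 : (n' i : ℝ) < n i + 1 := by linarith
      have h5 : n i < n' i + 1 := by exact_mod_cast h5
      have h6 : n' i < n i + 1 := by exact_mod_cast h6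
      omega
    subst h3
    have h7 : y = y' := add_right_cancel h1
    subst h7
    rfl
  have hsurj : Function.Surjective f := by
    rintro ⟨x, ⟨t, ht, hx⟩, hm⟩
    have key : x - ∑ i, ((⌊t i⌋₊ : ℕ) : ℝ) • v i = ∑ i, (t i - ⌊t i⌋₊) • v i := by
      simp [hx, sub_smul, Finset.sum_sub_distrib]
    refine ⟨⟨⟨x - ∑ i, ((⌊t i⌋₊ : ℕ) : ℝ) • v i, ⟨fun i => t i - ⌊t i⌋₊, fun i => ⟨?_, ?_⟩, key⟩,
      fun j => ?_⟩, fun i => ⌊t i⌋₊⟩, ?_⟩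
    · exact sub_nonneg.2 (Nat.floor_le (ht i))
    · have := Nat.lt_floor_add_one (t i)
      linarith
    · obtain ⟨m, hm⟩ := hm j
      refine ⟨m - ∑ i, (⌊t i⌋₊ : ℤ) * w i j, ?_⟩
      push_cast
      simp [hm, hw]
    · apply Subtype.ext
      simp [f]
  let e : B × (Fin d → ℕ) ≃ C := Equiv.ofBijective f ⟨hinj, hsurj⟩
  have hgeo := hasSum_geom_pi d (fun i => Real.exp ⟪ξ, v i⟫) (fun i => (Real.exp_pos _).le)
    (fun i => by rw [← Real.exp_zero]; exact Real.exp_lt_exp.2 (hξ i))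
  have hBs : Summable (fun y : B => Real.exp ⟪ξ, y.1⟫) := Summable.of_finite
  have hmul := hBs.hasSum.mul hgeo (summable_mul_aux hBs hgeo.summable
    (fun y => (Real.exp_pos _).le)
    (fun n => Finset.prod_nonneg fun i _ => pow_nonneg (Real.exp_pos _).le _))
  have hmain : HasSum (fun x : C => Real.exp ⟪ξ, x.1⟫)
      ((∑' y : B, Real.exp ⟪ξ, y.1⟫) * ∏ i, 1 / (1 - Real.exp ⟪ξ, v i⟫)) := by
    rw [← e.hasSum_iff]
    have hfe : (fun x : C => Real.exp ⟪ξ, x.1⟫) ∘ e =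
        fun p => Real.exp ⟪ξ, p.1.1⟫ * ∏ i, Real.exp ⟪ξ, v i⟫ ^ p.2 i := by
      funext p
      change Real.exp ⟪ξ, p.1.1 + ∑ i, (p.2 i : ℝ) • v i⟫ = _
      rw [inner_add_right, Real.exp_add, inner_sum, Real.exp_sum]
      congr 1
      refine Finset.prod_congr rfl fun i _ => ?_
      rw [inner_smul_right, Real.exp_nat_mul]
    rw [hfe]
    simp only [one_div]
    exact hmul
  exact ⟨hmain.summable, hfin, hmain.tsum_eq⟩
end

section
/- Let v₁,…,v_d be linearly independent vectors in ℤ^d and let c = ℝ≥0 v₁ + … + ℝ≥0 v_d. Then there exist an open neighborhood U of 0 in ℝ^d and a real-analytic function f on U such that for every ξ ∈ U with ⟨ξ,vᵢ⟩ < 0 for all i, f(ξ) = (∏_{i=1}^{d} ⟨ξ,vᵢ⟩) · Σ_{x ∈ c ∩ ℤ^d} e^{⟨ξ,x⟩}. In other words, the function ξ ↦ ∏_{i=1}^{d} ⟨ξ,vᵢ⟩ · S(c)(ξ) is holomorphic near 0. -/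
open scoped RealInnerProductSpace

lemma aux_hasSum_pi (d : ℕ) : ∀ (r : Fin d → ℝ), (∀ i, 0 ≤ r i ∧ r i < 1) →
    HasSum (fun n : Fin d → ℕ => ∏ i, r i ^ n i) (∏ i, (1 - r i)⁻¹) := by
  induction d with
  | zero =>
    intro r _
    simp only [Finset.univ_eq_empty, Finset.prod_empty]
    have := hasSum_fintype (fun _ : Fin 0 → ℕ => (1 : ℝ))
    simpa using this
  | succ d ih =>
    intro r hr
    have h0 := hasSum_geometric_of_lt_one (hr 0).1 (hr 0).2
    have h1 := ih (fun i => r i.succ) (fun i => hr i.succ)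
    have hs := h0.summable.mul_of_nonneg h1.summable
      (fun n => pow_nonneg (hr 0).1 n)
      (fun n => Finset.prod_nonneg fun i _ => pow_nonneg (hr i.succ).1 _)
    have h := h0.mul h1 hs
    rw [Fin.prod_univ_succ, ← (Fin.consEquiv (fun _ : Fin (d+1) => ℕ)).hasSum_iff]
    have e : ((fun n : Fin (d+1) → ℕ => ∏ i, r i ^ n i) ∘ (Fin.consEquiv (fun _ : Fin (d+1) => ℕ)))
        = fun x => r 0 ^ x.1 * ∏ i, r i.succ ^ x.2 i := by
      funext x
      simp [Fin.prod_univ_succ, Fin.consEquiv]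
    rw [e]
    exact h

lemma aux_analytic : ∃ g : ℝ → ℝ, (∀ s, s < 0 → g s = s * (1 - Real.exp s)⁻¹) ∧
    AnalyticAt ℝ g 0 := by
  obtain ⟨p, hp⟩ := (analyticAt_rexp (x := 0))
  have h : AnalyticAt ℝ (dslope Real.exp 0) 0 :=
    hp.has_fpower_series_dslope_fslope.analyticAt
  refine ⟨fun s => -(dslope Real.exp 0 s)⁻¹, ?_, ?_⟩
  · intro s hs
    beta_reduce
    rw [dslope_of_ne _ hs.ne, slope_def_field]
    simp only [Real.exp_zero, sub_zero, inv_div]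
    rw [← neg_sub (Real.exp s) 1, inv_neg]
    ring
  · refine (h.inv ?_).neg
    simp [dslope_same]

/-- the function `ξ ↦ (∏ᵢ ⟨ξ, vᵢ⟩) · S(c)(ξ)` is analytic near `0`: there is an
open neighborhood `U` of `0` and a real-analytic function `f` on `U` agreeing with
`(∏ᵢ ⟨ξ, vᵢ⟩) · Σ_{x ∈ c ∩ ℤ^d} e^{⟨ξ,x⟩}` on the set where all `⟨ξ, vᵢ⟩ < 0`. -/
theorem prod_mul_cone_exp_sum_analytic_near_zero
    (d : ℕ) (v : Fin d → EuclideanSpace ℝ (Fin d))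
    (hv : ∀ i, ∀ j, ∃ m : ℤ, v i j = (m : ℝ))
    (hindep : LinearIndependent ℝ v)
    (c : Set (EuclideanSpace ℝ (Fin d)))
    (hc : c = {x | ∃ t : Fin d → ℝ, (∀ i, 0 ≤ t i) ∧ x = ∑ i, t i • v i}) :
    ∃ (U : Set (EuclideanSpace ℝ (Fin d))) (f : EuclideanSpace ℝ (Fin d) → ℝ),
      IsOpen U ∧ (0 : EuclideanSpace ℝ (Fin d)) ∈ U ∧ AnalyticOnNhd ℝ f U ∧
      ∀ ξ ∈ U, (∀ i, ⟪ξ, v i⟫ < 0) →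
        f ξ = (∏ i, ⟪ξ, v i⟫) *
          ∑' x : {x : EuclideanSpace ℝ (Fin d) // x ∈ c ∧ ∀ j, ∃ m : ℤ, x j = (m : ℝ)},
            Real.exp ⟪ξ, (x : EuclideanSpace ℝ (Fin d))⟫ := by
  subst hc
  obtain ⟨g, hg, hga⟩ := aux_analytic
  choose w hw using hv
  let P : Set (EuclideanSpace ℝ (Fin d)) :=
    {p | ∃ t : Fin d → ℝ, (∀ i, 0 ≤ t i ∧ t i < 1) ∧ p = ∑ i, t i • v i ∧
      ∀ j, ∃ m : ℤ, p j = (m : ℝ)}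
  have hP : P.Finite := by
    refine ((Set.finite_Icc (fun j => -∑ i, |w i j|) (fun j => ∑ i, |w i j|)).image
      (fun z : Fin d → ℤ => WithLp.toLp 2 (fun j => (z j : ℝ)))).subset ?_
    rintro p ⟨t, ht, hpt, hm⟩
    choose m hm using hm
    have hb : ∀ j, |m j| ≤ ∑ i, |w i j| := by
      intro j
      have : |p j| ≤ ∑ i, |v i j| := by
        rw [hpt]
        simp only [WithLp.ofLp_sum, WithLp.ofLp_smul, Finset.sum_apply, Pi.smul_apply, smul_eq_mul]
        refine (Finset.abs_sum_le_sum_abs _ _).trans (Finset.sum_le_sum fun i _ => ?_)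
        rw [abs_mul, abs_of_nonneg (ht i).1]
        exact mul_le_of_le_one_left (abs_nonneg _) (ht i).2.le
      simp only [hm, hw] at this
      exact_mod_cast this
    refine ⟨m, ⟨fun j => (abs_le.1 (hb j)).1, fun j => (abs_le.1 (hb j)).2⟩, ?_⟩
    ext j
    simp [hm]
  have : Fintype P := hP.fintype
  let F : P × (Fin d → ℕ) → {x : EuclideanSpace ℝ (Fin d) //
      x ∈ {x | ∃ t : Fin d → ℝ, (∀ i, 0 ≤ t i) ∧ x = ∑ i, t i • v i} ∧
        ∀ j, ∃ m : ℤ, x j = (m : ℝ)} := fun q => ⟨q.1 + ∑ i, (q.2 i : ℝ) • v i, by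
      obtain ⟨⟨p, t, ht, hpt, hm⟩, n⟩ := q
      refine ⟨⟨fun i => t i + n i, fun i => add_nonneg (ht i).1 (Nat.cast_nonneg _), ?_⟩, ?_⟩
      · simp [hpt, add_smul, Finset.sum_add_distrib]
      · intro j
        obtain ⟨m, hm⟩ := hm j
        refine ⟨m + ∑ i, n i * w i j, ?_⟩
        simp [hm, hw]⟩
  have hF : Function.Bijective F := by
    constructor
    · rintro ⟨⟨p, t, ht, hpt, hm⟩, n⟩ ⟨⟨p', t', ht', hpt', hm'⟩, n'⟩ h
      have h := congrArg Subtype.val h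
      simp only [F, hpt, hpt', ← Finset.sum_add_distrib, ← add_smul] at h
      have h2 : ∀ i, t i + n i = t' i + n' i := by
        intro i
        have := Fintype.linearIndependent_iff.1 hindep
          (fun i => (t i + n i) - (t' i + n' i)) (by
            simp only [sub_smul, Finset.sum_sub_distrib]; rw [h, sub_self]) i
        linarith
      have h3 : n = n' := by
        ext i
        have a := ht i
        have b := ht' i
        have e := h2 i
        have l1 : (n i : ℝ) < n' i + 1 := by linarith
        have l2 : (n' i : ℝ) < n i + 1 := by linarith
        norm_cast at l1 l2
        omega
      subst h3
      have h4 : t = t' := by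
        ext i
        simpa using h2 i
      subst h4
      simp [hpt, hpt']
    · rintro ⟨x, ⟨t, ht, hx⟩, hm⟩
      choose m hm' using id hm
      have key : x = ∑ i, (t i - ⌊t i⌋₊) • v i + ∑ i, ((⌊t i⌋₊ : ℕ) : ℝ) • v i := by
        rw [← Finset.sum_add_distrib, hx]
        simp [← add_smul]
      refine ⟨⟨⟨∑ i, (t i - ⌊t i⌋₊) • v i, fun i => t i - ⌊t i⌋₊, ?_, rfl, ?_⟩,
        fun i => ⌊t i⌋₊⟩, ?_⟩
      · intro i
        have := Nat.floor_le (ht i)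
        have := Nat.lt_floor_add_one (t i)
        constructor <;> linarith
      · intro j
        refine ⟨m j - ∑ i, (⌊t i⌋₊ : ℤ) * w i j, ?_⟩
        rw [← sub_eq_iff_eq_add] at key
        rw [← key]
        simp [hm', hw]
      · exact Subtype.ext key.symm
  let f : EuclideanSpace ℝ (Fin d) → ℝ := fun ξ =>
    (∏ i, g ⟪ξ, v i⟫) * ∑ p : P, Real.exp ⟪ξ, (p : EuclideanSpace ℝ (Fin d))⟫
  have hin : ∀ u : EuclideanSpace ℝ (Fin d), AnalyticAt ℝ (fun ξ => ⟪ξ, u⟫) 0 := by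
    intro u
    have := (innerSL ℝ u).analyticAt 0
    refine this.congr (Filter.Eventually.of_forall fun ξ => ?_)
    simp [real_inner_comm]
  have hfa : AnalyticAt ℝ f 0 := by
    refine AnalyticAt.mul ?_ ?_
    · refine Finset.analyticAt_fun_prod _ fun i _ => ?_
      exact AnalyticAt.fun_comp (by simpa using hga) (hin (v i))
    · exact Finset.analyticAt_fun_sum _ fun p _ => (hin p).rexp
  refine ⟨{x | AnalyticAt ℝ f x}, f, isOpen_analyticAt ℝ f, hfa, fun x hx => hx, ?_⟩
  intro ξ _ hξ
  have h1 := aux_hasSum_pi d (fun i => Real.exp ⟪ξ, v i⟫)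
    (fun i => ⟨(Real.exp_pos _).le, by simpa using Real.exp_lt_exp.2 (hξ i)⟩)
  have h0 := hasSum_fintype (fun p : P => Real.exp ⟪ξ, (p : EuclideanSpace ℝ (Fin d))⟫)
  have hs := h0.summable.mul_of_nonneg h1.summable
      (fun n => (Real.exp_pos _).le)
      (fun n => Finset.prod_nonneg fun i _ => pow_nonneg (Real.exp_pos _).le _)
  have h := h0.mul h1 hs
  rw [← (Equiv.ofBijective F hF).tsum_eq]
  have e : ∀ q, Real.exp ⟪ξ, ((Equiv.ofBijective F hF q : _) : EuclideanSpace ℝ (Fin d))⟫ =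
      Real.exp ⟪ξ, (q.1 : EuclideanSpace ℝ (Fin d))⟫ * ∏ i, Real.exp ⟪ξ, v i⟫ ^ q.2 i := by
    intro q
    simp only [Equiv.ofBijective_apply, F, inner_add_right, inner_sum, inner_smul_right,
      Real.exp_add, Real.exp_sum, Real.exp_nat_mul]
  simp only [e]
  rw [h.tsum_eq]
  simp only [f, hg _ (hξ _), Finset.prod_mul_distrib]
  ring
end

section
/- Let c = ℝ≥0 v₁ + … + ℝ≥0 vₖ be a pointed rational polyhedral cone in ℝ^d and let ξ ∈ ℝ^d satisfy ⟨ξ,x⟩ < 0 for every x ∈ c \ {0}. Then the function x ↦ e^{⟨ξ,x⟩} is Lebesgue-integrable on c (with respect to the standard Lebesgue measure of ℝ^d). -/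
open scoped RealInnerProductSpace

lemma aux_exp_norm_integrable (d : ℕ) (δ : ℝ) (hδ : 0 < δ) :
    MeasureTheory.Integrable
      (fun x : EuclideanSpace ℝ (Fin d) => Real.exp (-δ * ‖x‖)) MeasureTheory.volume := by
  have h := (integrable_one_add_norm (E := EuclideanSpace ℝ (Fin d))
    (μ := MeasureTheory.volume) (r := ((d + 1 : ℕ) : ℝ)) (by simp)).const_mul
      (Real.exp δ * (d + 1).factorial / δ ^ (d + 1))
  refine h.mono' (by fun_prop) (Filter.Eventually.of_forall fun x => ?_)
  have hr : 0 ≤ ‖x‖ := norm_nonneg x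
  have hp : 0 < 1 + ‖x‖ := by positivity
  have key := Real.pow_div_factorial_le_exp (δ * (1 + ‖x‖)) (by positivity) (d + 1)
  have he : Real.exp (δ * (1 + ‖x‖)) = Real.exp δ * Real.exp (δ * ‖x‖) := by
    rw [← Real.exp_add]; ring_nf
  rw [he, div_le_iff₀ (by positivity), mul_pow] at key
  rw [Real.norm_of_nonneg (Real.exp_pos _).le, Real.rpow_neg hp.le, Real.rpow_natCast,
    neg_mul, Real.exp_neg, ← div_eq_mul_inv, div_div, le_div_iff₀ (by positivity),
    inv_mul_le_iff₀ (Real.exp_pos _)]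
  linarith

/-- for a pointed rational polyhedral cone `c` and `ξ` with `⟨ξ, x⟩ < 0` for
every nonzero `x ∈ c`, the function `x ↦ e^{⟨ξ,x⟩}` is Lebesgue-integrable on `c`. -/
theorem cone_exp_integrable
    (d k : ℕ) (v : Fin k → EuclideanSpace ℝ (Fin d))
    (hv : ∀ i, ∀ j, ∃ n : ℤ, v i j = (n : ℝ))
    (c : Set (EuclideanSpace ℝ (Fin d)))
    (hc : c = {x | ∃ t : Fin k → ℝ, (∀ i, 0 ≤ t i) ∧ x = ∑ i, t i • v i})
    (hpointed : c ∩ (-c) = {0})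
    (ξ : EuclideanSpace ℝ (Fin d))
    (hξ : ∀ x ∈ c, x ≠ 0 → ⟪ξ, x⟫ < 0) :
    MeasureTheory.IntegrableOn
      (fun x : EuclideanSpace ℝ (Fin d) => Real.exp ⟪ξ, x⟫) c MeasureTheory.volume := by
  have hmem : ∀ i, v i ∈ c := by
    intro i
    rw [hc]
    refine ⟨Pi.single i 1, fun j => ?_, ?_⟩
    · by_cases h : j = i
      · subst h; simp
      · simp [h]
    · simp [Pi.single_apply]
  have h1 : ∀ i, ∃ δ : ℝ, 0 < δ ∧ ⟪ξ, v i⟫ ≤ -δ * ‖v i‖ := by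
    intro i
    by_cases h : v i = 0
    · exact ⟨1, one_pos, by simp [h]⟩
    · have hn : 0 < ‖v i‖ := norm_pos_iff.mpr h
      refine ⟨-⟪ξ, v i⟫ / ‖v i‖, div_pos (neg_pos.mpr (hξ _ (hmem i) h)) hn, ?_⟩
      have : -(-⟪ξ, v i⟫ / ‖v i‖) * ‖v i‖ = ⟪ξ, v i⟫ := by field_simp
      exact this.ge
  choose D hD0 hD using h1
  obtain ⟨δ, hδ, hδD⟩ : ∃ δ : ℝ, 0 < δ ∧ ∀ i, δ ≤ D i := by
    rcases isEmpty_or_nonempty (Fin k) with h | h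
    · exact ⟨1, one_pos, fun i => h.elim i⟩
    · obtain ⟨i, hi⟩ := Finite.exists_min D
      exact ⟨D i, hD0 i, hi⟩
  have hsub : c ⊆ {x | ⟪ξ, x⟫ ≤ -δ * ‖x‖} := by
    intro x hx
    rw [hc] at hx
    obtain ⟨t, ht, rfl⟩ := hx
    simp only [Set.mem_setOf_eq, inner_sum, inner_smul_right]
    have hnorm : ‖∑ i, t i • v i‖ ≤ ∑ i, t i * ‖v i‖ := by
      refine (norm_sum_le _ _).trans (Finset.sum_le_sum fun i _ => ?_)
      rw [norm_smul, Real.norm_of_nonneg (ht i)]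
    have h2 : ∑ i, t i * ⟪ξ, v i⟫ ≤ ∑ i, -δ * (t i * ‖v i‖) := by
      refine Finset.sum_le_sum fun i _ => ?_
      have h3 : ⟪ξ, v i⟫ ≤ -δ * ‖v i‖ := by
        nlinarith [hD i, mul_le_mul_of_nonneg_right (hδD i) (norm_nonneg (v i))]
      nlinarith [mul_le_mul_of_nonneg_left h3 (ht i)]
    rw [← Finset.mul_sum] at h2
    nlinarith [mul_le_mul_of_nonneg_left hnorm hδ.le]
  have hmeas : MeasurableSet {x : EuclideanSpace ℝ (Fin d) | ⟪ξ, x⟫ ≤ -δ * ‖x‖} :=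
    (isClosed_le (by fun_prop) (by fun_prop)).measurableSet
  refine MeasureTheory.IntegrableOn.mono_set ?_ hsub
  refine MeasureTheory.Integrable.mono' (aux_exp_norm_integrable d δ hδ).integrableOn
    (Continuous.aestronglyMeasurable (by fun_prop)) ?_
  filter_upwards [MeasureTheory.ae_restrict_mem hmeas] with x hx
  rw [Real.norm_of_nonneg (Real.exp_pos _).le]
  exact Real.exp_le_exp.mpr hx
end

section
/- Let c be a pointed rational polyhedral cone in ℝ^d with lin(c) = ℝ^d, and let c* = {ξ ∈ ℝ^d : ⟨ξ,x⟩ ≥ 0 for all x ∈ c} be its dual cone. For each edge (one-dimensional face) τ of c*, let n_τ ∈ ℤ^d be the primitive lattice generator of τ, and let f_τ = c ∩ τ^⊥ be the corresponding facet of c, equipped with the Lebesgue measure dm_τ on lin(f_τ) normalized so that a fundamental domain of the lattice ℤ^d ∩ lin(f_τ) has measure 1. Then for every v ∈ ℝ^d and every ξ ∈ ℝ^d with ⟨ξ,x⟩ < 0 for all x ∈ c \ {0}: −⟨v,ξ⟩ · ∫_c e^{⟨ξ,x⟩} dx = Σ_{τ edge of c*} ⟨v,n_τ⟩ · ∫_{f_τ}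 e^{⟨ξ,x⟩} dm_τ(x), where dx is the standard Lebesgue measure on ℝ^d. -/
open scoped RealInnerProductSpace

/-- The dual cone of a subset of `ℝ^d`. -/
def dualSet {d : ℕ} (c : Set (EuclideanSpace ℝ (Fin d))) : Set (EuclideanSpace ℝ (Fin d)) :=
  {ξ | ∀ x ∈ c, 0 ≤ ⟪ξ, x⟫}

/-- A face of a cone `c` is a subset of the form `c ∩ ξ^⊥` with `ξ ∈ c*`
(this includes `c` itself, taking `ξ = 0`). -/
def IsFaceOf {d : ℕ} (c F : Set (EuclideanSpace ℝ (Fin d))) : Prop :=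
  ∃ ξ ∈ dualSet c, F = {x ∈ c | ⟪ξ, x⟫ = 0}

/-- A point of `ℝ^d` all of whose coordinates are integers. -/
def IsLatticePt {d : ℕ} (x : EuclideanSpace ℝ (Fin d)) : Prop :=
  ∀ j, ∃ n : ℤ, x j = (n : ℝ)

/-- A lattice vector is primitive if it is not an integer multiple `≥ 2`
of another lattice vector. -/
def IsPrimitive {d : ℕ} (x : EuclideanSpace ℝ (Fin d)) : Prop :=
  IsLatticePt x ∧
    ¬ ∃ (m : ℕ) (w : EuclideanSpace ℝ (Fin d)), 2 ≤ m ∧ IsLatticePt w ∧ x = (m : ℝ) • w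

theorem aux_bound {d k : ℕ} (u : Fin k → EuclideanSpace ℝ (Fin d))
    (c : Set (EuclideanSpace ℝ (Fin d)))
    (hc : c = {x | ∃ t : Fin k → ℝ, (∀ i, 0 ≤ t i) ∧ x = ∑ i, t i • u i})
    (ξ : EuclideanSpace ℝ (Fin d))
    (hξ : ∀ x ∈ c, x ≠ 0 → ⟪ξ, x⟫ < 0) :
    ∃ M : ℝ, 0 < M ∧ ∀ x ∈ c, ∃ t : Fin k → ℝ,
      (∀ i, 0 ≤ t i ∧ t i ≤ M * (-⟪ξ, x⟫)) ∧ x = ∑ i, t i • u i := by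
  have hu : ∀ i, u i ∈ c := by
    intro i
    rw [hc]
    refine ⟨fun j => if j = i then 1 else 0, fun j => by positivity, by simp⟩
  have hneg : ∀ i, 0 ≤ -⟪ξ, u i⟫ := by
    intro i
    by_cases h : u i = 0
    · simp [h]
    · linarith [hξ _ (hu i) h]
  refine ⟨∑ i, |⟪ξ, u i⟫|⁻¹ + 1, by positivity, ?_⟩
  intro x hx
  have hx' := hx
  rw [hc] at hx'
  obtain ⟨t, ht, rfl⟩ := hx'
  set X := ∑ i, t i • u i with hX
  have hsum : -⟪ξ, X⟫ = ∑ i, t i * (-⟪ξ, u i⟫) := by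
    simp [hX, inner_sum, inner_smul_right]
  have hXn : 0 ≤ -⟪ξ, X⟫ := by
    rw [hsum]; exact Finset.sum_nonneg fun i _ => mul_nonneg (ht i) (hneg i)
  refine ⟨fun i => if u i = 0 then 0 else t i, ?_, ?_⟩
  · intro i
    by_cases h : u i = 0
    · simp only [h, if_true, le_refl, true_and]
      exact mul_nonneg (by positivity) hXn
    · simp only [h, if_false]
      refine ⟨ht i, ?_⟩
      have h1 : t i * (-⟪ξ, u i⟫) ≤ -⟪ξ, X⟫ := by
        rw [hsum]
        exact Finset.single_le_sum (f := fun i => t i * (-⟪ξ, u i⟫))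
          (fun j _ => mul_nonneg (ht j) (hneg j)) (Finset.mem_univ i)
      have h2 : |⟪ξ, u i⟫|⁻¹ ≤ ∑ i, |⟪ξ, u i⟫|⁻¹ + 1 := by
        have := Finset.single_le_sum (f := fun i => |⟪ξ, u i⟫|⁻¹)
          (fun j _ => by positivity) (Finset.mem_univ i)
        linarith
      have h3 := hξ _ (hu i) h
      have h4 : |⟪ξ, u i⟫| = -⟪ξ, u i⟫ := abs_of_neg h3
      calc t i = |⟪ξ, u i⟫|⁻¹ * (t i * (-⟪ξ, u i⟫)) := by
            have h5 := h3.ne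
            rw [h4]; field_simp
        _ ≤ _ := mul_le_mul h2 h1 (mul_nonneg (ht i) (hneg i)) (by positivity)
  · rw [hX]
    refine Finset.sum_congr rfl fun i _ => ?_
    by_cases h : u i = 0 <;> simp [h]

theorem aux_norm {d k : ℕ} (u : Fin k → EuclideanSpace ℝ (Fin d))
    (c : Set (EuclideanSpace ℝ (Fin d)))
    (hc : c = {x | ∃ t : Fin k → ℝ, (∀ i, 0 ≤ t i) ∧ x = ∑ i, t i • u i})
    (ξ : EuclideanSpace ℝ (Fin d))
    (hξ : ∀ x ∈ c, x ≠ 0 → ⟪ξ, x⟫ < 0) :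
    ∃ δ : ℝ, 0 < δ ∧ ∀ x ∈ c, ⟪ξ, x⟫ ≤ - (δ * ‖x‖) := by
  obtain ⟨M, hM, h⟩ := aux_bound u c hc ξ hξ
  refine ⟨(M * ∑ i, ‖u i‖ + 1)⁻¹, by positivity, ?_⟩
  intro x hx
  obtain ⟨t, ht, hxt⟩ := h x hx
  have h0 : 0 ≤ -⟪ξ, x⟫ := by
    by_cases h : x = 0
    · simp [h]
    · linarith [hξ _ hx h]
  have h1 : ‖x‖ ≤ (M * ∑ i, ‖u i‖) * (-⟪ξ, x⟫) := by
    calc ‖x‖ = ‖∑ i, t i • u i‖ := by rw [← hxt]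
      _ ≤ ∑ i, ‖t i • u i‖ := norm_sum_le _ _
      _ ≤ ∑ i, (M * (-⟪ξ, x⟫)) * ‖u i‖ := by
          refine Finset.sum_le_sum fun i _ => ?_
          rw [norm_smul, Real.norm_of_nonneg (ht i).1]
          exact mul_le_mul_of_nonneg_right (ht i).2 (norm_nonneg _)
      _ = _ := by rw [← Finset.mul_sum]; ring
  have h2 : (0:ℝ) < M * ∑ i, ‖u i‖ + 1 := by positivity
  have h3 : ‖x‖ ≤ (M * ∑ i, ‖u i‖ + 1) * (-⟪ξ, x⟫) := by nlinarith
  have h4 : (M * ∑ i, ‖u i‖ + 1)⁻¹ * ‖x‖ ≤ -⟪ξ, x⟫ := by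
    rw [inv_mul_le_iff₀ h2]; exact h3
  linarith

theorem aux_closed {d k : ℕ} (u : Fin k → EuclideanSpace ℝ (Fin d))
    (c : Set (EuclideanSpace ℝ (Fin d)))
    (hc : c = {x | ∃ t : Fin k → ℝ, (∀ i, 0 ≤ t i) ∧ x = ∑ i, t i • u i})
    (ξ : EuclideanSpace ℝ (Fin d))
    (hξ : ∀ x ∈ c, x ≠ 0 → ⟪ξ, x⟫ < 0) : IsClosed c := by
  obtain ⟨M, hM, h⟩ := aux_bound u c hc ξ hξ
  refine isClosed_of_closure_subset fun x hx => ?_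
  set R : ℝ := M * (‖ξ‖ * (‖x‖ + 1))
  set φ : (Fin k → ℝ) → EuclideanSpace ℝ (Fin d) := fun t => ∑ i, t i • u i
  have hφ : Continuous φ := by fun_prop
  have hK : IsCompact (φ '' (Set.Icc (fun _ => 0) (fun _ => R))) := isCompact_Icc.image hφ
  have hsub : φ '' (Set.Icc (fun _ => 0) (fun _ => R)) ⊆ c := by
    rintro _ ⟨t, ht, rfl⟩
    rw [hc]
    exact ⟨t, fun i => ht.1 i, rfl⟩
  apply hsub
  rw [← hK.isClosed.closure_eq]
  have h1 : x ∈ closure (Metric.ball x 1 ∩ c) :=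
    (mem_closure_iff_nhds.2 fun V hV => by
      obtain ⟨y, hy⟩ := mem_closure_iff_nhds.1 hx _ (Filter.inter_mem hV (Metric.ball_mem_nhds x one_pos))
      exact ⟨y, hy.1.1, hy.1.2, hy.2⟩)
  refine closure_mono ?_ h1
  rintro y ⟨hy, hyc⟩
  obtain ⟨t, ht, hyt⟩ := h y hyc
  refine ⟨t, ⟨fun i => (ht i).1, fun i => (ht i).2.trans ?_⟩, hyt.symm⟩
  have h2 : ‖y‖ ≤ ‖x‖ + 1 := by
    have : ‖y - x‖ < 1 := by simpa [dist_eq_norm] using hy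
    have := norm_le_norm_add_norm_sub' y x
    linarith
  have h3 : -⟪ξ, y⟫ ≤ ‖ξ‖ * ‖y‖ := by
    have := abs_real_inner_le_norm ξ y
    linarith [neg_abs_le ⟪ξ, y⟫]
  refine mul_le_mul_of_nonneg_left (h3.trans ?_) hM.le
  exact mul_le_mul_of_nonneg_left h2 (norm_nonneg _)

theorem aux_farkas {d k : ℕ} (u : Fin k → EuclideanSpace ℝ (Fin d))
    (c : Set (EuclideanSpace ℝ (Fin d)))
    (hc : c = {x | ∃ t : Fin k → ℝ, (∀ i, 0 ≤ t i) ∧ x = ∑ i, t i • u i})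
    (hcl : IsClosed c) (x : EuclideanSpace ℝ (Fin d)) (hx : x ∉ c) :
    ∃ y : EuclideanSpace ℝ (Fin d), (∀ i, 0 ≤ ⟪y, u i⟫) ∧ ⟪y, x⟫ < 0 := by
  have hu : ∀ i, u i ∈ c := by
    intro i
    rw [hc]
    refine ⟨fun j => if j = i then 1 else 0, fun j => by positivity, by simp⟩
  have hconv : Convex ℝ c := by
    rw [hc]
    rintro _ ⟨t, ht, rfl⟩ _ ⟨s, hs, rfl⟩ a b ha hb _
    refine ⟨fun i => a * t i + b * s i, fun i => ?_, ?_⟩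
    · have := ht i; have := hs i; positivity
    · simp [Finset.smul_sum, add_smul, Finset.sum_add_distrib, mul_smul]
  have hsm : ∀ a : ℝ, 0 ≤ a → ∀ y ∈ c, a • y ∈ c := by
    intro a ha y hy
    rw [hc] at hy ⊢
    obtain ⟨t, ht, rfl⟩ := hy
    exact ⟨fun i => a * t i, fun i => mul_nonneg ha (ht i), by simp [Finset.smul_sum, mul_smul]⟩
  obtain ⟨g, s, h1, h2⟩ := geometric_hahn_banach_point_closed hconv hcl hx
  have h0 : (0 : EuclideanSpace ℝ (Fin d)) ∈ c := by
    rw [hc]; exact ⟨0, by simp, by simp⟩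
  have hs : s < 0 := by simpa using h2 0 h0
  refine ⟨(InnerProductSpace.toDual ℝ _).symm g, ?_, ?_⟩
  · intro i
    rw [InnerProductSpace.toDual_symm_apply]
    by_contra hneg
    push Not at hneg
    have := h2 _ (hsm (s / g (u i)) (div_nonneg_of_nonpos hs.le hneg.le) _ (hu i))
    rw [map_smul, smul_eq_mul, div_mul_cancel₀ _ hneg.ne] at this
    exact lt_irrefl _ this
  · rw [InnerProductSpace.toDual_symm_apply]; linarith

/-- extremal functional -/
theorem aux_extreme {d k : ℕ} (u : Fin k → EuclideanSpace ℝ (Fin d))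
    (hspan : Submodule.span ℝ (Set.range u) = ⊤)
    (x : EuclideanSpace ℝ (Fin d))
    (hex : ∃ y : EuclideanSpace ℝ (Fin d), (∀ i, 0 ≤ ⟪y, u i⟫) ∧ ⟪y, x⟫ < 0) :
    ∃ y : EuclideanSpace ℝ (Fin d), (∀ i, 0 ≤ ⟪y, u i⟫) ∧ ⟪y, x⟫ < 0 ∧
      ∀ z : EuclideanSpace ℝ (Fin d), (∀ i, ⟪y, u i⟫ = 0 → ⟪z, u i⟫ = 0) → ∃ a : ℝ, z = a • y := by
  classical
  let Z : EuclideanSpace ℝ (Fin d) → Finset (Fin k) := fun y => Finset.univ.filter fun i => ⟪y, u i⟫ = 0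
  have hbdd : ∃ N : ℕ, ∀ y ∈ {y : EuclideanSpace ℝ (Fin d) | (∀ i, 0 ≤ ⟪y, u i⟫) ∧ ⟪y, x⟫ < 0}, (Z y).card ≤ N :=
    ⟨k, fun y _ => by simpa using Finset.card_le_univ (Z y)⟩
  obtain ⟨y, ⟨hy1, hy2⟩, hmax⟩ : ∃ y ∈ {y : EuclideanSpace ℝ (Fin d) | (∀ i, 0 ≤ ⟪y, u i⟫) ∧ ⟪y, x⟫ < 0},
      ∀ y' ∈ {y : EuclideanSpace ℝ (Fin d) | (∀ i, 0 ≤ ⟪y, u i⟫) ∧ ⟪y, x⟫ < 0}, (Z y').card ≤ (Z y).card := by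
    obtain ⟨y0, hy0⟩ := hex
    have hfin : ((fun y => (Z y).card) '' {y : EuclideanSpace ℝ (Fin d) | (∀ i, 0 ≤ ⟪y, u i⟫) ∧ ⟪y, x⟫ < 0}).Finite :=
      (Set.finite_Iic k).subset (by
        rintro _ ⟨y, _, rfl⟩
        simpa using Finset.card_le_univ (Z y))
    obtain ⟨_, ⟨y, hy, rfl⟩, hm⟩ := Set.exists_max_image _ id hfin ⟨_, ⟨y0, hy0, rfl⟩⟩
    exact ⟨y, hy, fun y' hy' => hm _ ⟨y', hy', rfl⟩⟩
  refine ⟨y, hy1, hy2, ?_⟩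
  intro z hz
  by_contra hno
  push Not at hno
  -- adjusted direction
  have key : ∀ w : EuclideanSpace ℝ (Fin d), (∀ i, ⟪y, u i⟫ = 0 → ⟪w, u i⟫ = 0) → ⟪w, x⟫ = 0 →
      (∃ i, ⟪w, u i⟫ < 0) → False := by
    intro w hw hwx ⟨i0, hi0⟩
    let S : Finset (Fin k) := Finset.univ.filter fun i => ⟪w, u i⟫ < 0
    have hS : S.Nonempty := ⟨i0, by simp [S, hi0]⟩
    obtain ⟨j, hjS, hj⟩ := Finset.exists_min_image S (fun i => ⟪y, u i⟫ / (-⟪w, u i⟫)) hS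
    have hjw : ⟪w, u j⟫ < 0 := by simpa [S] using hjS
    set s := ⟪y, u j⟫ / (-⟪w, u j⟫) with hs
    have hs0 : 0 ≤ s := div_nonneg (hy1 j) (by linarith)
    have hmem : y + s • w ∈ {y : EuclideanSpace ℝ (Fin d) | (∀ i, 0 ≤ ⟪y, u i⟫) ∧ ⟪y, x⟫ < 0} := by
      refine ⟨fun i => ?_, ?_⟩
      · rw [inner_add_left, real_inner_smul_left]
        by_cases hi : ⟪w, u i⟫ < 0
        · have := hj i (by simp [S, hi])
          rw [le_div_iff₀ (by linarith)] at this
          linarith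
        · push Not at hi
          have := hy1 i
          positivity
      · rw [inner_add_left, real_inner_smul_left, hwx]; linarith
    have hlt : Z y ⊂ Z (y + s • w) := by
      rw [Finset.ssubset_iff_of_subset]
      · refine ⟨j, ?_, ?_⟩
        · simp only [Z, Finset.mem_filter, Finset.mem_univ, true_and]
          rw [inner_add_left, real_inner_smul_left, hs]
          have h5 := hjw.ne
          field_simp
          ring
        · simp only [Z, Finset.mem_filter, Finset.mem_univ, true_and]
          intro h
          exact hjw.ne (hw j h)
      · intro i hi
        simp only [Z, Finset.mem_filter, Finset.mem_univ, true_and] at hi ⊢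
        rw [inner_add_left, real_inner_smul_left, hi, hw i hi]; simp
    exact absurd (hmax _ hmem) (not_le.mpr (Finset.card_lt_card hlt))
  set w := z - (⟪z, x⟫ / ⟪y, x⟫) • y with hwdef
  have hw0 : w ≠ 0 := fun h => hno _ (sub_eq_zero.mp h)
  have hw1 : ∀ i, ⟪y, u i⟫ = 0 → ⟪w, u i⟫ = 0 := by
    intro i hi
    rw [hwdef, inner_sub_left, real_inner_smul_left, hi, hz i hi]; simp
  have hwx : ⟪w, x⟫ = 0 := by
    rw [hwdef, inner_sub_left, real_inner_smul_left, div_mul_cancel₀ _ hy2.ne, sub_self]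
  have hex : ∃ i, ⟪w, u i⟫ ≠ 0 := by
    by_contra hall
    push Not at hall
    apply hw0
    have : ∀ p ∈ Submodule.span ℝ (Set.range u), ⟪w, p⟫ = 0 := by
      intro p hp
      induction hp using Submodule.span_induction with
      | mem p hp => obtain ⟨i, rfl⟩ := hp; exact hall i
      | zero => simp
      | add a b _ _ ha hb => rw [inner_add_right, ha, hb, add_zero]
      | smul a b _ hb => rw [inner_smul_right, hb, mul_zero]
    have := this w (hspan ▸ Submodule.mem_top)
    exact inner_self_eq_zero.mp this
  obtain ⟨i, hi⟩ := hex
  rcases lt_or_gt_of_ne hi with h | h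
  · exact key w hw1 hwx ⟨i, h⟩
  · refine key (-w) (fun i hi => by rw [inner_neg_left, hw1 i hi, neg_zero]) (by rw [inner_neg_left, hwx, neg_zero]) ⟨i, ?_⟩
    rw [inner_neg_left]; linarith

theorem aux_integrable {d : ℕ} (c : Set (EuclideanSpace ℝ (Fin d))) (hcl : IsClosed c)
    (ξ : EuclideanSpace ℝ (Fin d))
    (h : ∃ δ : ℝ, 0 < δ ∧ ∀ x ∈ c, ⟪ξ, x⟫ ≤ - (δ * ‖x‖)) :
    MeasureTheory.IntegrableOn (fun x => Real.exp ⟪ξ, x⟫) c := by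
  obtain ⟨δ, hδ, h⟩ := h
  have h1 := integrable_one_add_norm (E := EuclideanSpace ℝ (Fin d)) (μ := MeasureTheory.volume)
    (r := ((d + 1 : ℕ) : ℝ)) (by simp)
  have h2 := (h1.const_mul (Real.exp δ * ((d+1).factorial / δ ^ (d+1)))).integrableOn (s := c)
  refine MeasureTheory.Integrable.mono' h2 ?_ ?_
  · exact Continuous.aestronglyMeasurable (by fun_prop)
  · refine (MeasureTheory.ae_restrict_iff' hcl.measurableSet).2 (Filter.Eventually.of_forall ?_)
    intro x hx
    rw [Real.norm_of_nonneg (Real.exp_pos _).le, Real.rpow_neg (by positivity), Real.rpow_natCast]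
    have h3 := Real.pow_div_factorial_le_exp (x := δ * (1 + ‖x‖)) (by positivity) (d+1)
    calc Real.exp ⟪ξ, x⟫ ≤ Real.exp (- (δ * ‖x‖)) := Real.exp_le_exp.2 (h x hx)
      _ = Real.exp δ * (Real.exp (δ * (1 + ‖x‖)))⁻¹ := by
          rw [← Real.exp_neg, ← Real.exp_add]; congr 1; ring
      _ ≤ Real.exp δ * ((δ * (1 + ‖x‖)) ^ (d+1) / (d+1).factorial)⁻¹ := by
          gcongr
      _ = _ := by
          rw [mul_pow, inv_div, mul_assoc]
          congr 1
          field_simp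

theorem aux_bezout {d : ℕ} (n : EuclideanSpace ℝ (Fin d)) (hn : IsPrimitive n) :
    ∃ v : EuclideanSpace ℝ (Fin d), IsLatticePt v ∧ ⟪n, v⟫ = 1 := by
  obtain ⟨hl, hp⟩ := hn
  choose N hN using hl
  obtain ⟨g, hg⟩ := IsPrincipalIdealRing.principal (Ideal.span (Set.range N))
  have hg' : Ideal.span (Set.range N) = Ideal.span {g} := hg
  have hdvd : ∀ j, g ∣ N j := by
    intro j
    rw [← Ideal.mem_span_singleton, ← hg']
    exact Ideal.subset_span ⟨j, rfl⟩
  have hunit : g.natAbs = 1 := by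
    by_contra hne
    apply hp
    rcases Nat.lt_or_ge g.natAbs 2 with h | h
    · have h0 : g = 0 := by omega
      refine ⟨2, 0, le_rfl, fun j => ⟨0, by simp⟩, ?_⟩
      ext j
      have := hdvd j
      rw [h0, zero_dvd_iff] at this
      simp [hN, this]
    · have hd : ∀ j, (g.natAbs : ℤ) ∣ N j := fun j => Int.natAbs_dvd.2 (hdvd j)
      choose w hw using hd
      refine ⟨g.natAbs, WithLp.toLp 2 (fun j => (w j : ℝ)), h, fun j => ⟨w j, by simp⟩, ?_⟩
      ext j
      rw [hN, hw]
      simp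
  have h1 : (1 : ℤ) ∈ Ideal.span (Set.range N) := by
    rw [hg', Ideal.mem_span_singleton]
    exact (Int.isUnit_iff_natAbs_eq.2 hunit).dvd
  obtain ⟨a, ha⟩ := (Ideal.mem_span_range_iff_exists_fun).1 h1
  refine ⟨WithLp.toLp 2 (fun j => (a j : ℝ)), fun j => ⟨a j, by simp⟩, ?_⟩
  have : (∑ j, (a j : ℝ) * N j) = 1 := by exact_mod_cast ha
  rw [PiLp.inner_apply]
  simpa [hN, mul_comm] using this

theorem aux_det {m : ℕ} (n : EuclideanSpace ℝ (Fin (m+1))) (hn : IsPrimitive n)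
    (b : Fin m → EuclideanSpace ℝ (Fin (m+1))) (hb : ∀ i, IsLatticePt (b i))
    (hbn : ∀ i, ⟪n, b i⟫ = 0)
    (hgen : ∀ x : EuclideanSpace ℝ (Fin (m+1)), IsLatticePt x → ⟪n, x⟫ = 0 →
      ∃ z : Fin m → ℤ, x = ∑ i, (z i : ℝ) • b i)
    (v : EuclideanSpace ℝ (Fin (m+1))) :
    |Matrix.det (Matrix.of (Fin.cons (fun j => v j) (fun i j => b i j) :
      Fin (m+1) → Fin (m+1) → ℝ))| = |⟪n, v⟫| := by
  obtain ⟨v0, hv0, hnv0⟩ := aux_bezout n hn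
  have hn0 : n ≠ 0 := by rintro rfl; simp at hnv0
  let D : (Fin (m+1) → ℝ) → ℝ := fun w => Matrix.det (Matrix.of (Fin.cons w (fun i j => b i j) :
      Fin (m+1) → Fin (m+1) → ℝ))
  have hD : ∀ w, D w = Matrix.det (Matrix.updateRow (Matrix.of (Fin.cons 0 (fun i j => b i j) :
      Fin (m+1) → Fin (m+1) → ℝ)) 0 w) := by
    intro w
    simp only [D]
    congr 1
    ext i j
    refine Fin.cases ?_ (fun i => ?_) i <;> simp [Matrix.updateRow_apply]
  have hadd : ∀ w w', D (w + w') = D w + D w' := by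
    intro w w'; simp only [hD, Matrix.det_updateRow_add]
  have hsmul : ∀ (a : ℝ) w, D (a • w) = a * D w := by
    intro a w; simp only [hD, Matrix.det_updateRow_smul]
  have hzero : ∀ r : EuclideanSpace ℝ (Fin (m+1)), ⟪n, r⟫ = 0 → D (fun j => r j) = 0 := by
    intro r hr
    apply Matrix.exists_mulVec_eq_zero_iff.1
    refine ⟨fun j => n j, fun h => hn0 (by ext j; exact congrFun h j), ?_⟩
    ext i
    refine Fin.cases ?_ (fun i => ?_) i
    · rw [PiLp.inner_apply] at hr
      simpa [Matrix.mulVec, dotProduct, mul_comm] using hr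
    · have := hbn i
      rw [PiLp.inner_apply] at this
      simpa [Matrix.mulVec, dotProduct, mul_comm] using this
  have hDv : D (fun j => v j) = ⟪n, v⟫ * D (fun j => v0 j) := by
    have h0 := hzero (v - ⟪n, v⟫ • v0) (by rw [inner_sub_right, inner_smul_right, hnv0]; ring)
    have he : (fun j => v j) = ⟪n, v⟫ • (fun j => v0 j) + fun j => (v - ⟪n, v⟫ • v0) j := by
      ext j; simp
    rw [he, hadd, hsmul, h0, add_zero]
  have h1 : |D (fun j => v0 j)| = 1 := by
    have hlat : ∀ i j, ∃ a : ℤ, (Matrix.of (Fin.cons (fun j => v0 j) (fun i j => b i j) :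
      Fin (m+1) → Fin (m+1) → ℝ)) i j = (a : ℝ) := by
      intro i j
      refine Fin.cases ?_ (fun i => ?_) i
      · simpa using hv0 j
      · simpa using hb i j
    choose M hM using hlat
    have hnl : ∀ j, ∃ a : ℤ, n j = a := hn.1
    choose N hN using hnl
    have hrow : ∀ j : Fin (m+1), ∃ p : Fin (m+1) → ℤ, ∀ l,
        (if j = l then (1:ℝ) else 0) = ∑ i, (p i : ℝ) * (M i l : ℝ) := by
      intro j
      have hin : ⟪n, EuclideanSpace.single j (1:ℝ)⟫ = N j := by
        rw [EuclideanSpace.inner_single_right]; simp [hN]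
      obtain ⟨z, hz⟩ := hgen (EuclideanSpace.single j (1:ℝ) - (N j : ℝ) • v0) (by
          intro l
          obtain ⟨a, ha⟩ := hv0 l
          by_cases h : l = j
          · exact ⟨1 - N j * a, by simp [h, ← ha]⟩
          · exact ⟨- N j * a, by simp [h, ha]⟩) (by
          rw [inner_sub_right, inner_smul_right, hnv0, hin]; ring)
      refine ⟨Fin.cons (N j) z, fun l => ?_⟩
      have hzl := congrArg (fun x : EuclideanSpace ℝ (Fin (m+1)) => x l) hz
      simp only [PiLp.sub_apply, PiLp.smul_apply, smul_eq_mul, WithLp.ofLp_sum, Finset.sum_apply, WithLp.ofLp_smul, Pi.smul_apply] at hzl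
      rw [Fin.sum_univ_succ]
      simp only [← hM, Fin.cons_zero, Fin.cons_succ, Matrix.of_apply]
      rw [← hzl]
      simp [eq_comm]
    choose P hP using hrow
    have hPM : Matrix.of P * Matrix.of M = 1 := by
      ext j l
      have := hP j l
      rw [Matrix.mul_apply, Matrix.one_apply]
      simp only [Matrix.of_apply]
      exact_mod_cast this.symm
    have hu : IsUnit (Matrix.of M).det :=
      IsUnit.of_mul_eq_one (Matrix.of P).det (by rw [mul_comm, ← Matrix.det_mul, hPM, Matrix.det_one])
    have hcast : D (fun j => v0 j) = ((Matrix.of M).det : ℝ) := by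
      have := Int.cast_det (R := ℝ) (Matrix.of M)
      rw [this]
      simp only [D]
      congr 1
      ext i j
      rw [hM]; rfl
    rw [hcast]
    rcases Int.isUnit_iff.1 hu with h | h <;> simp [h]
  change |D (fun j => v j)| = _
  rw [hDv, abs_mul, h1, mul_one]

theorem aux_change {m : ℕ} (b : Fin m → EuclideanSpace ℝ (Fin (m+1)))
    (v : EuclideanSpace ℝ (Fin (m+1)))
    (hD : Matrix.det (Matrix.of (Fin.cons (fun j => v j) (fun i j => b i j) :
      Fin (m+1) → Fin (m+1) → ℝ)) ≠ 0) (ξ : EuclideanSpace ℝ (Fin (m+1))) (hv : ⟪ξ, v⟫ < 0)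
    (C : Set (EuclideanSpace ℝ (Fin (m+1)))) (hC : MeasurableSet C)
    (S : Set (EuclideanSpace ℝ (Fin m)))
    (hCS : ∀ (s : ℝ) (t : EuclideanSpace ℝ (Fin m)), s • v + ∑ i, t i • b i ∈ C ↔ 0 ≤ s ∧ t ∈ S) :
    -⟪ξ, v⟫ * ∫ x in C, Real.exp ⟪ξ, x⟫ =
      |Matrix.det (Matrix.of (Fin.cons (fun j => v j) (fun i j => b i j) :
      Fin (m+1) → Fin (m+1) → ℝ))| * ∫ t in S, Real.exp ⟪ξ, ∑ i, t i • b i⟫ := by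
  set A := Matrix.of (Fin.cons (fun j => v j) (fun i j => b i j) :
      Fin (m+1) → Fin (m+1) → ℝ) with hA
  let φ : ℝ × EuclideanSpace ℝ (Fin m) → EuclideanSpace ℝ (Fin (m+1)) :=
    fun p => p.1 • v + ∑ i, p.2 i • b i
  have hφ : MeasureTheory.MeasurePreserving φ (MeasureTheory.volume.prod MeasureTheory.volume)
      (ENNReal.ofReal |A.det⁻¹| • MeasureTheory.volume) := by
    have h1 : MeasureTheory.MeasurePreserving
        (Prod.map id (WithLp.ofLp) : ℝ × EuclideanSpace ℝ (Fin m) → ℝ × (Fin m → ℝ))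
        (MeasureTheory.volume.prod MeasureTheory.volume)
        (MeasureTheory.volume.prod MeasureTheory.volume) :=
      (MeasureTheory.MeasurePreserving.id _).prod (PiLp.volume_preserving_ofLp (Fin m))
    have h2 := (MeasureTheory.volume_preserving_piFinSuccAbove (fun _ : Fin (m+1) => ℝ) 0).symm
    have h3 : MeasureTheory.MeasurePreserving (Matrix.toLin' A.transpose) MeasureTheory.volume
        (ENNReal.ofReal |A.det⁻¹| • MeasureTheory.volume) := by
      refine ⟨(LinearMap.continuous_of_finiteDimensional _).measurable, ?_⟩
      rw [Real.map_matrix_volume_pi_eq_smul_volume_pi (by rwa [Matrix.det_transpose]),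
        Matrix.det_transpose]
    have h4 := (PiLp.volume_preserving_toLp (Fin (m+1))).smul_measure (ENNReal.ofReal |A.det⁻¹|)
    have h5 := h4.comp (h3.comp (h2.comp h1))
    have hφeq : φ = (WithLp.toLp 2) ∘ (Matrix.toLin' A.transpose) ∘
        (MeasurableEquiv.piFinSuccAbove (fun _ : Fin (m+1) => ℝ) 0).symm ∘ Prod.map id WithLp.ofLp := by
      ext p j
      simp [φ, Matrix.mulVec, dotProduct, Fin.sum_univ_succ, hA, MeasurableEquiv.piFinSuccAbove,
      Fin.insertNthEquiv, mul_comm]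
    rw [hφeq]
    exact h5
  have hpre : φ ⁻¹' C = Set.Ici 0 ×ˢ S := by
    ext ⟨s, t⟩
    simpa [φ] using hCS s t
  have h6 := MeasureTheory.setIntegral_map (μ := MeasureTheory.volume.prod MeasureTheory.volume)
    (g := φ) (f := fun x => Real.exp ⟪ξ, x⟫) hC
    (Continuous.aestronglyMeasurable (by fun_prop)) hφ.measurable.aemeasurable
  rw [hφ.map_eq, hpre] at h6
  have h7 : ∀ p : ℝ × EuclideanSpace ℝ (Fin m), Real.exp ⟪ξ, φ p⟫ =
      Real.exp (⟪ξ, v⟫ * p.1) * Real.exp ⟪ξ, ∑ i, p.2 i • b i⟫ := by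
    intro p
    rw [← Real.exp_add, inner_add_right, inner_smul_right, mul_comm]
  simp only [h7] at h6
  rw [MeasureTheory.setIntegral_prod_mul (fun s : ℝ => Real.exp (⟪ξ, v⟫ * s))
    (fun t : EuclideanSpace ℝ (Fin m) => Real.exp ⟪ξ, ∑ i, t i • b i⟫),
    MeasureTheory.integral_Ici_eq_integral_Ioi, integral_exp_mul_Ioi hv,
    MeasureTheory.Measure.restrict_smul, MeasureTheory.integral_smul_measure,
    ENNReal.toReal_ofReal (abs_nonneg _), smul_eq_mul, abs_inv] at h6
  have h8 : |A.det| ≠ 0 := abs_ne_zero.2 hD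
  have h9 := hv.ne
  simp only [mul_zero, Real.exp_zero] at h6
  field_simp at h6
  linarith

theorem aux_main
    (m k : ℕ) (u : Fin k → EuclideanSpace ℝ (Fin (m+1)))
    (c : Set (EuclideanSpace ℝ (Fin (m+1))))
    (hc : c = {x | ∃ t : Fin k → ℝ, (∀ i, 0 ≤ t i) ∧ x = ∑ i, t i • u i})
    (hpointed : c ∩ (-c) = {0})
    (hfull : Submodule.span ℝ c = ⊤)
    (T : Finset (Set (EuclideanSpace ℝ (Fin (m+1)))))
    (hT : ∀ τ : Set (EuclideanSpace ℝ (Fin (m+1))),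
      τ ∈ T ↔ IsFaceOf (dualSet c) τ ∧ Module.finrank ℝ (Submodule.span ℝ τ) = 1)
    (n : Set (EuclideanSpace ℝ (Fin (m+1))) → EuclideanSpace ℝ (Fin (m+1)))
    (hn_prim : ∀ τ ∈ T, IsPrimitive (n τ))
    (hn_gen : ∀ τ ∈ T, τ = {x | ∃ t : ℝ, 0 ≤ t ∧ x = t • n τ})
    (f : Set (EuclideanSpace ℝ (Fin (m+1))) → Set (EuclideanSpace ℝ (Fin (m+1))))
    (hf : ∀ τ ∈ T, f τ = {x ∈ c | ∀ y ∈ τ, ⟪y, x⟫ = 0})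
    (b : Set (EuclideanSpace ℝ (Fin (m+1))) → Fin m → EuclideanSpace ℝ (Fin (m+1)))
    (hb_lat : ∀ τ ∈ T, ∀ i, IsLatticePt (b τ i))
    (hb_mem : ∀ τ ∈ T, ∀ i, b τ i ∈ Submodule.span ℝ (f τ))
    (hb_basis : ∀ τ ∈ T, ∀ x : EuclideanSpace ℝ (Fin (m+1)),
      IsLatticePt x → x ∈ Submodule.span ℝ (f τ) →
        ∃! z : Fin m → ℤ, x = ∑ i, (z i : ℝ) • b τ i)
    (v ξ : EuclideanSpace ℝ (Fin (m+1)))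
    (hξ : ∀ x ∈ c, x ≠ 0 → ⟪ξ, x⟫ < 0) :
    -⟪v, ξ⟫ * ∫ x in c, Real.exp ⟪ξ, x⟫ =
      ∑ τ ∈ T, ⟪v, n τ⟫ *
        ∫ t in {t : EuclideanSpace ℝ (Fin m) | (∑ i, t i • b τ i) ∈ f τ},
          Real.exp ⟪ξ, ∑ i, t i • b τ i⟫ := by
  classical
  have hu : ∀ i, u i ∈ c := by
    intro i
    rw [hc]
    refine ⟨fun j => if j = i then 1 else 0, fun j => by positivity, by simp⟩
  have hspan : Submodule.span ℝ (Set.range u) = ⊤ := by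
    rw [eq_top_iff, ← hfull, Submodule.span_le]
    intro x hx
    rw [hc] at hx
    obtain ⟨t, _, rfl⟩ := hx
    exact Submodule.sum_mem _ fun i _ => Submodule.smul_mem _ _ (Submodule.subset_span ⟨i, rfl⟩)
  have hcl := aux_closed u c hc ξ hξ
  have hcadd : ∀ x ∈ c, ∀ y ∈ c, ∀ s : ℝ, 0 ≤ s → s • y + x ∈ c := by
    intro x hx y hy s hs
    rw [hc] at hx hy ⊢
    obtain ⟨t, ht, rfl⟩ := hx
    obtain ⟨t', ht', rfl⟩ := hy
    refine ⟨fun i => s * t' i + t i, fun i => ?_, ?_⟩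
    · have := ht i; have := ht' i; positivity
    · simp [Finset.smul_sum, add_smul, Finset.sum_add_distrib, mul_smul]
  have hdual : ∀ y, y ∈ dualSet c ↔ ∀ i, 0 ≤ ⟪y, u i⟫ := by
    intro y
    refine ⟨fun h i => h _ (hu i), fun h x hx => ?_⟩
    rw [hc] at hx
    obtain ⟨t, ht, rfl⟩ := hx
    simp only [inner_sum, inner_smul_right]
    exact Finset.sum_nonneg fun i _ => mul_nonneg (ht i) (h i)
  have hzero : ∀ w : EuclideanSpace ℝ (Fin (m+1)), (∀ i, ⟪w, u i⟫ = 0) → w = 0 := by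
    intro w hall
    have : ∀ p ∈ Submodule.span ℝ (Set.range u), ⟪w, p⟫ = 0 := by
      intro p hp
      induction hp using Submodule.span_induction with
      | mem p hp => obtain ⟨i, rfl⟩ := hp; exact hall i
      | zero => simp
      | add a b _ _ ha hb => rw [inner_add_right, ha, hb, add_zero]
      | smul a b _ hb => rw [inner_smul_right, hb, mul_zero]
    exact inner_self_eq_zero.mp (this w (hspan ▸ Submodule.mem_top))
  have hnτ : ∀ τ ∈ T, n τ ∈ τ := by
    intro τ hτ
    rw [hn_gen τ hτ]
    refine ⟨1, zero_le_one, ?_⟩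
    rw [← hn_gen τ hτ, one_smul]
  have hnd : ∀ τ ∈ T, n τ ∈ dualSet c := by
    intro τ hτ
    obtain ⟨⟨p, hp, hτp⟩, -⟩ := (hT τ).1 hτ
    have := hnτ τ hτ
    rw [hτp] at this
    rw [hτp]
    exact this.1
  have hn0 : ∀ τ ∈ T, n τ ≠ 0 := by
    intro τ hτ h0
    obtain ⟨v, _, h⟩ := aux_bezout _ (hn_prim τ hτ)
    rw [h0] at h
    simp at h
  have hfeq : ∀ τ ∈ T, f τ = {x ∈ c | ⟪n τ, x⟫ = 0} := by
    intro τ hτ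
    rw [hf τ hτ]
    ext x
    refine and_congr_right fun _ => ⟨fun h => h _ (hnτ τ hτ), fun h y hy => ?_⟩
    rw [hn_gen τ hτ] at hy
    obtain ⟨t, _, rfl⟩ := hy
    rw [real_inner_smul_left, h, mul_zero]
  -- half-space description
  have hH : ∀ x, (∀ τ ∈ T, 0 ≤ ⟪n τ, x⟫) → x ∈ c := by
    intro x hx
    by_contra hxc
    obtain ⟨y, hy1, hy2, hy3⟩ := aux_extreme u hspan x (aux_farkas u c hc hcl x hxc)
    set p := ∑ i ∈ Finset.univ.filter (fun i => ⟪y, u i⟫ = 0), u i with hp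
    have hyp : y ∈ {z ∈ dualSet c | ⟪p, z⟫ = 0} := by
      refine ⟨(hdual y).2 hy1, ?_⟩
      rw [hp, sum_inner]
      refine Finset.sum_eq_zero fun i hi => ?_
      rw [real_inner_comm]
      simpa using hi
    have hy0 : y ≠ 0 := by rintro rfl; simp at hy2
    have hτT : {z ∈ dualSet c | ⟪p, z⟫ = 0} ∈ T := by
      rw [hT]
      refine ⟨⟨p, ?_, rfl⟩, ?_⟩
      · intro z hz
        rw [hp, sum_inner]
        refine Finset.sum_nonneg fun i _ => ?_
        rw [real_inner_comm]
        exact hz _ (hu i)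
      · have : Submodule.span ℝ {z ∈ dualSet c | ⟪p, z⟫ = 0} = Submodule.span ℝ {y} := by
          apply le_antisymm
          · rw [Submodule.span_le]
            rintro z ⟨hz, hpz⟩
            rw [hp, sum_inner, Finset.sum_eq_zero_iff_of_nonneg
              (fun i _ => by rw [real_inner_comm]; exact hz _ (hu i))] at hpz
            obtain ⟨a, rfl⟩ := hy3 z (fun i hi => by
              rw [real_inner_comm]; exact hpz i (by simpa using hi))
            exact Submodule.smul_mem _ _ (Submodule.mem_span_singleton_self y)
          · rw [Submodule.span_le, Set.singleton_subset_iff]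
            exact Submodule.subset_span hyp
        rw [this, finrank_span_singleton hy0]
    have h1 := hyp
    rw [hn_gen _ hτT] at h1
    obtain ⟨t, ht, hyt⟩ := h1
    have h2 := hx _ hτT
    rw [hn_gen _ hτT] at hyt
    rw [← hn_gen _ hτT] at hyt
    have h3 : ⟪y, x⟫ = t * ⟪n {z ∈ dualSet c | ⟪p, z⟫ = 0}, x⟫ := by
      conv_lhs => rw [hyt]
      rw [real_inner_smul_left]
    have := mul_nonneg ht h2
    linarith
  -- span of facets
  have hspanf : ∀ τ ∈ T, ∀ x, ⟪n τ, x⟫ = 0 → x ∈ Submodule.span ℝ (f τ) := by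
    intro τ hτ x hx
    rw [← Submodule.orthogonal_orthogonal (Submodule.span ℝ (f τ)), Submodule.mem_orthogonal]
    intro z hz
    have hz' : ∀ w ∈ f τ, ⟪z, w⟫ = 0 := fun w hw =>
      Submodule.inner_left_of_mem_orthogonal (Submodule.subset_span hw) hz
    suffices h : ∃ a : ℝ, z = a • n τ by
      obtain ⟨a, rfl⟩ := h
      rw [real_inner_smul_left, hx, mul_zero]
    have hni := (hdual _).1 (hnd τ hτ)
    set ε : ℝ := (∑ i, |⟪z, u i⟫| / ⟪n τ, u i⟫ + 1)⁻¹ with hε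
    have hpos : 0 < ∑ i, |⟪z, u i⟫| / ⟪n τ, u i⟫ + 1 :=
      add_pos_of_nonneg_of_pos
        (Finset.sum_nonneg fun i _ => div_nonneg (abs_nonneg _) (hni i)) one_pos
    have hε0 : 0 < ε := inv_pos.2 hpos
    obtain ⟨⟨p, hp, hτp⟩, -⟩ := (hT τ).1 hτ
    have hpc : p ∈ c := by
      apply hH
      intro σ hσ
      rw [real_inner_comm]
      exact hp _ (hnd σ hσ)
    have hpn : ⟪p, n τ⟫ = 0 := by
      have := hnτ τ hτ
      rw [hτp] at this
      have h2 := this.2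
      rw [← hτp] at h2
      exact h2
    have hpf : p ∈ f τ := by
      rw [hfeq τ hτ]
      exact ⟨hpc, by rw [real_inner_comm]; exact hpn⟩
    have hmem : n τ + ε • z ∈ τ := by
      have : n τ + ε • z ∈ {x ∈ dualSet c | ⟪p, x⟫ = 0} := by
        refine ⟨(hdual _).2 fun i => ?_, ?_⟩
        · rw [inner_add_left, real_inner_smul_left]
          rcases (hni i).eq_or_lt with h | h
          · rw [hz' (u i) (by rw [hfeq τ hτ]; exact ⟨hu i, h.symm⟩), ← h]; simp
          · have h1 : |⟪z, u i⟫| / ⟪n τ, u i⟫ ≤ ∑ i, |⟪z, u i⟫| / ⟪n τ, u i⟫ + 1 := by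
              have := Finset.single_le_sum (f := fun i => |⟪z, u i⟫| / ⟪n τ, u i⟫)
                (fun j _ => div_nonneg (abs_nonneg _) (hni j)) (Finset.mem_univ i)
              linarith
            have h2 : ε * |⟪z, u i⟫| ≤ ⟪n τ, u i⟫ := by
              rw [hε, inv_mul_le_iff₀ hpos]
              rwa [div_le_iff₀ h] at h1
            have h3 := neg_abs_le ⟪z, u i⟫
            nlinarith
        · rw [inner_add_right, inner_smul_right, hpn, real_inner_comm, hz' p hpf]; simp
      rw [hτp]
      rw [← hτp] at this ⊢
      exact this
    rw [hn_gen τ hτ] at hmem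
    obtain ⟨t, _, ht⟩ := hmem
    rw [← hn_gen τ hτ] at ht
    refine ⟨ε⁻¹ * (t - 1), ?_⟩
    have h4 : ε • z = (t - 1) • n τ := by
      rw [sub_smul, one_smul, ← ht]; abel
    rw [mul_smul, ← h4, smul_smul, inv_mul_cancel₀ hε0.ne', one_smul]
  have hbn : ∀ τ ∈ T, ∀ i, ⟪n τ, b τ i⟫ = 0 := by
    intro τ hτ i
    have hm := hb_mem τ hτ i
    generalize b τ i = y at hm
    induction hm using Submodule.span_induction with
    | mem p hp => rw [hfeq τ hτ] at hp; exact hp.2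
    | zero => simp
    | add a b _ _ ha hb => rw [inner_add_right, ha, hb, add_zero]
    | smul a b _ hb => rw [inner_smul_right, hb, mul_zero]
  have hdet : ∀ τ ∈ T, ∀ v : EuclideanSpace ℝ (Fin (m+1)),
      |Matrix.det (Matrix.of (Fin.cons (fun j => v j) (fun i j => b τ i j) :
      Fin (m+1) → Fin (m+1) → ℝ))| = |⟪n τ, v⟫| := by
    intro τ hτ v
    exact aux_det (n τ) (hn_prim τ hτ) (b τ) (hb_lat τ hτ) (hbn τ hτ)
      (fun x hx hx0 => (hb_basis τ hτ x hx (hspanf τ hτ x hx0)).exists) v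
  have hTne : T.Nonempty := by
    by_contra h
    rw [Finset.not_nonempty_iff_eq_empty] at h
    have hall : ∀ x, x ∈ c := fun x => hH x (by simp [h])
    have : (EuclideanSpace.single 0 (1:ℝ) : EuclideanSpace ℝ (Fin (m+1))) ∈ c ∩ (-c) :=
      ⟨hall _, hall _⟩
    rw [hpointed] at this
    simp at this
  have hint := aux_integrable c hcl ξ (aux_norm u c hc ξ hξ)
  have key : ∀ v ∈ c, (∀ τ ∈ T, 0 < ⟪n τ, v⟫) →
      -⟪v, ξ⟫ * ∫ x in c, Real.exp ⟪ξ, x⟫ =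
      ∑ τ ∈ T, ⟪v, n τ⟫ *
        ∫ t in {t : EuclideanSpace ℝ (Fin m) | (∑ i, t i • b τ i) ∈ f τ},
          Real.exp ⟪ξ, ∑ i, t i • b τ i⟫ := by
    intro v hv hpos
    have hv0 : v ≠ 0 := by
      rintro rfl
      obtain ⟨τ, hτ⟩ := hTne
      simpa using hpos τ hτ
    have hξv := hξ v hv hv0
    let r : Set (EuclideanSpace ℝ (Fin (m+1))) → EuclideanSpace ℝ (Fin (m+1)) → ℝ :=
      fun τ x => ⟪n τ, x⟫ / ⟪n τ, v⟫
    let C : Set (EuclideanSpace ℝ (Fin (m+1))) → Set (EuclideanSpace ℝ (Fin (m+1))) :=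
      fun τ => {x | x ∈ c ∧ x - r τ x • v ∈ c}
    have hCcl : ∀ τ, IsClosed (C τ) := by
      intro τ
      have h1 : Continuous fun x : EuclideanSpace ℝ (Fin (m+1)) => x - r τ x • v := by
        simp only [r]
        fun_prop
      exact hcl.inter (hcl.preimage h1)
    have hrv : ∀ τ ∈ T, ∀ x, ⟪n τ, x - r τ x • v⟫ = 0 := by
      intro τ hτ x
      rw [inner_sub_right, inner_smul_right, div_mul_cancel₀ _ (hpos τ hτ).ne', sub_self]
    have hcov : c = ⋃ τ : T, C τ := by
      ext x
      simp only [Set.mem_iUnion]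
      refine ⟨fun hx => ?_, fun ⟨τ, h⟩ => h.1⟩
      obtain ⟨τ, hτ, hmin⟩ := Finset.exists_min_image T (fun τ => r τ x) hTne
      refine ⟨⟨τ, hτ⟩, hx, hH _ fun σ hσ => ?_⟩
      have := hmin σ hσ
      simp only [r] at this
      rw [le_div_iff₀ (hpos σ hσ)] at this
      rw [inner_sub_right, inner_smul_right]
      simp only [r]
      linarith
    have hdisj : Pairwise (Function.onFun (MeasureTheory.AEDisjoint MeasureTheory.volume)
        (fun τ : T => C τ)) := by
      rintro ⟨τ, hτ⟩ ⟨σ, hσ⟩ hne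
      have hne' : τ ≠ σ := fun h => hne (Subtype.ext h)
      set q := ⟪n σ, v⟫ • n τ - ⟪n τ, v⟫ • n σ with hq
      have hpτ := hpos τ hτ
      have hpσ := hpos σ hσ
      have hq0 : q ≠ 0 := by
        intro h
        apply hne'
        rw [hq, sub_eq_zero] at h
        have e1 : n τ = (⟪n τ, v⟫ / ⟪n σ, v⟫) • n σ := by
          rw [div_eq_inv_mul, mul_smul, ← h, smul_smul, inv_mul_cancel₀ hpσ.ne', one_smul]
        have e2 : n σ = (⟪n σ, v⟫ / ⟪n τ, v⟫) • n τ := by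
          rw [div_eq_inv_mul, mul_smul, h, smul_smul, inv_mul_cancel₀ hpτ.ne', one_smul]
        rw [hn_gen τ hτ, hn_gen σ hσ]
        ext x
        constructor
        · rintro ⟨t, ht, hx⟩
          refine ⟨t * (⟪n τ, v⟫ / ⟪n σ, v⟫), by positivity, ?_⟩
          rw [mul_smul, ← e1, hx]
        · rintro ⟨t, ht, hx⟩
          refine ⟨t * (⟪n σ, v⟫ / ⟪n τ, v⟫), by positivity, ?_⟩
          rw [mul_smul, ← e2, hx]
      have hnull : MeasureTheory.volume
          ((Submodule.span ℝ {q})ᗮ : Set (EuclideanSpace ℝ (Fin (m+1)))) = 0 := by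
        apply MeasureTheory.Measure.addHaar_submodule
        intro h
        have : q ∈ (Submodule.span ℝ {q})ᗮ := h ▸ Submodule.mem_top
        rw [Submodule.mem_orthogonal_singleton_iff_inner_right] at this
        exact hq0 (inner_self_eq_zero.1 this)
      refine MeasureTheory.measure_mono_null ?_ hnull
      rintro x ⟨⟨hxc, hx1⟩, ⟨_, hx2⟩⟩
      rw [SetLike.mem_coe, Submodule.mem_orthogonal_singleton_iff_inner_right]
      have i1 := hnd σ hσ _ hx1
      have i2 := hnd τ hτ _ hx2
      simp only at i1 i2
      rw [inner_sub_right, inner_smul_right] at i1 i2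
      simp only [r] at i1 i2
      rw [hq, inner_sub_left, real_inner_smul_left, real_inner_smul_left]
      have j1 : 0 ≤ ⟪n τ, v⟫ * ⟪n σ, x⟫ - ⟪n τ, x⟫ * ⟪n σ, v⟫ := by
        have := mul_nonneg hpτ.le i1
        field_simp at this
        linarith
      have j2 : 0 ≤ ⟪n σ, v⟫ * ⟪n τ, x⟫ - ⟪n σ, x⟫ * ⟪n τ, v⟫ := by
        have := mul_nonneg hpσ.le i2
        field_simp at this
        linarith
      linarith
    have hsum : ∫ x in c, Real.exp ⟪ξ, x⟫ = ∑ τ ∈ T, ∫ x in C τ, Real.exp ⟪ξ, x⟫ := by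
      have h1 := MeasureTheory.integral_iUnion_ae (μ := MeasureTheory.volume)
        (f := fun x => Real.exp ⟪ξ, x⟫) (s := fun τ : T => C τ)
        (fun τ => (hCcl τ).measurableSet.nullMeasurableSet) hdisj (hcov ▸ hint)
      rw [← hcov, tsum_fintype] at h1
      rw [h1]
      exact Finset.sum_coe_sort T (fun τ => ∫ x in C τ, Real.exp ⟪ξ, x⟫)
    rw [hsum, Finset.mul_sum]
    refine Finset.sum_congr rfl fun τ hτ => ?_
    have hd := hdet τ hτ v
    have hp := hpos τ hτ
    rw [real_inner_comm ξ v, real_inner_comm (n τ) v, ← abs_of_pos hp, ← hd]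
    apply aux_change
    · rw [← abs_ne_zero, hd]
      exact abs_ne_zero.2 hp.ne'
    · exact hξv
    · exact (hCcl τ).measurableSet
    · intro s t
      have hbt : ⟪n τ, ∑ i, t i • b τ i⟫ = 0 := by
        rw [inner_sum]
        exact Finset.sum_eq_zero fun i _ => by rw [inner_smul_right, hbn τ hτ i, mul_zero]
      have hr : r τ (s • v + ∑ i, t i • b τ i) = s := by
        simp only [r]
        rw [inner_add_right, inner_smul_right, hbt, add_zero, mul_div_cancel_right₀ _ hp.ne']
      simp only [C, Set.mem_ofPred_eq, hr, hfeq τ hτ, add_sub_cancel_left, hbt, and_true]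
      refine ⟨fun h => ⟨?_, h.2⟩, fun h => ⟨hcadd _ h.2 _ hv _ h.1, h.2⟩⟩
      have := hnd τ hτ _ h.1
      rw [inner_add_right, inner_smul_right, hbt, add_zero] at this
      exact nonneg_of_mul_nonneg_left this hp
  -- linearity
  set I := ∫ x in c, Real.exp ⟪ξ, x⟫ with hI
  set J : Set (EuclideanSpace ℝ (Fin (m+1))) → ℝ := fun τ =>
    ∫ t in {t : EuclideanSpace ℝ (Fin m) | (∑ i, t i • b τ i) ∈ f τ},
          Real.exp ⟪ξ, ∑ i, t i • b τ i⟫ with hJ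
  change -⟪v, ξ⟫ * I = ∑ τ ∈ T, ⟪v, n τ⟫ * J τ
  have key' : ∀ v ∈ c, (∀ τ ∈ T, 0 < ⟪n τ, v⟫) → -⟪v, ξ⟫ * I = ∑ τ ∈ T, ⟪v, n τ⟫ * J τ := key
  set v0 := ∑ i, u i with hv0
  have hv0c : v0 ∈ c := by
    rw [hc]
    exact ⟨fun _ => 1, by simp, by simp [hv0]⟩
  have hv0p : ∀ τ ∈ T, 0 < ⟪n τ, v0⟫ := by
    intro τ hτ
    have hni := (hdual _).1 (hnd τ hτ)
    refine lt_of_le_of_ne (hnd τ hτ _ hv0c) fun h => hn0 τ hτ (hzero _ fun i => ?_)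
    rw [hv0, inner_sum, eq_comm, Finset.sum_eq_zero_iff_of_nonneg (fun i _ => hni i)] at h
    exact h i (Finset.mem_univ i)
  have k0 := key' v0 hv0c hv0p
  have hv : v ∈ Submodule.span ℝ (Set.range u) := hspan ▸ Submodule.mem_top
  induction hv using Submodule.span_induction with
  | mem p hp =>
    obtain ⟨i, rfl⟩ := hp
    have k1 := key' ((1:ℝ) • u i + v0) (hcadd _ hv0c _ (hu i) 1 zero_le_one) (fun τ hτ => by
      rw [inner_add_right, one_smul]
      have := (hdual _).1 (hnd τ hτ) i
      linarith [hv0p τ hτ])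
    rw [one_smul] at k1
    simp only [inner_add_left, add_mul, Finset.sum_add_distrib] at k1
    linarith
  | zero => simp
  | add a b _ _ ha hb =>
    simp only [inner_add_left, add_mul, Finset.sum_add_distrib]
    linarith
  | smul a b _ hb =>
    simp only [real_inner_smul_left, mul_assoc, ← Finset.mul_sum]
    rw [← hb]; ring

/-- Lemma `relationsstokes`: for a pointed full-dimensional rational polyhedral
cone `c` with dual cone `c*`, primitive generators `n τ` of the edges `τ` of `c*`,
corresponding facets `f_τ = c ∩ τ^⊥` carrying the lattice-normalized Lebesgue measure
(written in the coordinates of a `ℤ`-basis `b τ` of the lattice `ℤ^d ∩ lin(f_τ)`), one has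
`-⟨v,ξ⟩ ∫_c e^{⟨ξ,x⟩} dx = Σ_τ ⟨v, n_τ⟩ ∫_{f_τ} e^{⟨ξ,x⟩} dm_τ(x)`. -/
theorem cone_exp_integral_stokes_relation
    (d k : ℕ) (u : Fin k → EuclideanSpace ℝ (Fin d))
    (hu : ∀ i, IsLatticePt (u i))
    (c : Set (EuclideanSpace ℝ (Fin d)))
    (hc : c = {x | ∃ t : Fin k → ℝ, (∀ i, 0 ≤ t i) ∧ x = ∑ i, t i • u i})
    (hpointed : c ∩ (-c) = {0})
    (hfull : Submodule.span ℝ c = ⊤)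
    (T : Finset (Set (EuclideanSpace ℝ (Fin d))))
    (hT : ∀ τ : Set (EuclideanSpace ℝ (Fin d)),
      τ ∈ T ↔ IsFaceOf (dualSet c) τ ∧ Module.finrank ℝ (Submodule.span ℝ τ) = 1)
    (n : Set (EuclideanSpace ℝ (Fin d)) → EuclideanSpace ℝ (Fin d))
    (hn_prim : ∀ τ ∈ T, IsPrimitive (n τ))
    (hn_gen : ∀ τ ∈ T, τ = {x | ∃ t : ℝ, 0 ≤ t ∧ x = t • n τ})
    (f : Set (EuclideanSpace ℝ (Fin d)) → Set (EuclideanSpace ℝ (Fin d)))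
    (hf : ∀ τ ∈ T, f τ = {x ∈ c | ∀ y ∈ τ, ⟪y, x⟫ = 0})
    (b : Set (EuclideanSpace ℝ (Fin d)) → Fin (d - 1) → EuclideanSpace ℝ (Fin d))
    (hb_lat : ∀ τ ∈ T, ∀ i, IsLatticePt (b τ i))
    (hb_mem : ∀ τ ∈ T, ∀ i, b τ i ∈ Submodule.span ℝ (f τ))
    (hb_basis : ∀ τ ∈ T, ∀ x : EuclideanSpace ℝ (Fin d),
      IsLatticePt x → x ∈ Submodule.span ℝ (f τ) →
        ∃! m : Fin (d - 1) → ℤ, x = ∑ i, (m i : ℝ) • b τ i)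
    (v ξ : EuclideanSpace ℝ (Fin d))
    (hξ : ∀ x ∈ c, x ≠ 0 → ⟪ξ, x⟫ < 0) :
    -⟪v, ξ⟫ * ∫ x in c, Real.exp ⟪ξ, x⟫ =
      ∑ τ ∈ T, ⟪v, n τ⟫ *
        ∫ t in {t : EuclideanSpace ℝ (Fin (d - 1)) | (∑ i, t i • b τ i) ∈ f τ},
          Real.exp ⟪ξ, ∑ i, t i • b τ i⟫ := by
  rcases d with _ | m
  · have hv : v = 0 := Subsingleton.elim _ _
    simp [hv]
  · exact aux_main m k u c hc hpointed hfull T hT n hn_prim hn_gen f hf b hb_lat hb_mem hb_basis v ξ hξ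
end

section
/- Let h be a real polynomial in one variable, and let a₁ ≤ a₂ be integers. Then Σ_{x=a₁}^{a₂} h(x) = ∫_{a₁}^{a₂} h(t) dt − Σ_{n≥1} (b(n)/n!) · h^{(n−1)}(a₁) + Σ_{n≥1} (−1)^n (b(n)/n!) · h^{(n−1)}(a₂), where h^{(n−1)} denotes the (n−1)-st derivative of h (only finitely many terms are nonzero, namely those with n ≤ deg h + 1). -/
theorem emX (p N : ℕ) (hp : p < N) (x : ℤ) :
    ∑ m ∈ Finset.range N, ((bernoulli (m + 1) : ℝ) / (Nat.factorial (m + 1) : ℝ)) *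
            (Polynomial.derivative^[m] (Polynomial.X ^ p : Polynomial ℝ)).eval (x : ℝ)
    = ((((Polynomial.bernoulli (p+1)).eval (x:ℚ) : ℚ) : ℝ) - x^(p+1)) / (p+1) := by
  rw [eq_div_iff (by positivity), Polynomial.bernoulli, Polynomial.eval_finsetSum, Finset.sum_range_succ']
  simp only [Polynomial.eval_monomial]
  push_cast
  simp only [bernoulli_zero, Nat.choose_zero_right, Rat.cast_one, Nat.cast_one, one_mul, add_sub_cancel_right]
  rw [← Finset.sum_subset (Finset.range_mono (show p + 1 ≤ N by omega)), Finset.sum_mul]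
  · refine Finset.sum_congr rfl fun m hm => ?_
    have hm' : m ≤ p := by simpa [Nat.lt_succ_iff] using hm
    rw [Polynomial.iterate_derivative_X_pow_eq_natCast_mul]
    simp only [Polynomial.eval_mul, Polynomial.eval_natCast, Polynomial.eval_pow, Polynomial.eval_X]
    have h1 : ((p+1).choose (m+1) : ℝ) * (Nat.factorial (m+1)) = (p+1) * p.descFactorial m := by
      have := Nat.descFactorial_eq_factorial_mul_choose (p+1) (m+1)
      rw [Nat.succ_descFactorial_succ] at this
      rw [mul_comm]; exact_mod_cast this.symm
    have h2 : (Nat.factorial (m+1) : ℝ) ≠ 0 := by positivity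
    field_simp
    linear_combination -(bernoulli (m+1) : ℝ) * (x:ℝ)^(p-m) * h1
  · intro m _ hm
    have : p < m := by simpa using hm
    rw [Polynomial.iterate_derivative_eq_zero (by simpa using this)]
    simp

theorem emStep (h : Polynomial ℝ) (N : ℕ) (hN : h.natDegree ≤ N) (x : ℤ) :
    h.eval (x:ℝ) = (∫ t in (x : ℝ)..((x+1 : ℤ) : ℝ), h.eval t) +
      ∑ m ∈ Finset.range (N+1), ((bernoulli (m + 1) : ℝ) / (Nat.factorial (m + 1) : ℝ)) *
            (Polynomial.derivative^[m] h).eval ((x+1 : ℤ) : ℝ) -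
      ∑ m ∈ Finset.range (N+1), ((bernoulli (m + 1) : ℝ) / (Nat.factorial (m + 1) : ℝ)) *
            (Polynomial.derivative^[m] h).eval (x : ℝ) := by
  revert h
  apply Polynomial.induction_with_natDegree_le
  · simp
  · intro p r hr hp
    simp only [Polynomial.iterate_derivative_C_mul, Polynomial.eval_mul, Polynomial.eval_C,
      mul_left_comm _ r, ← Finset.mul_sum]
    rw [emX p _ (by omega), emX p _ (by omega)]
    have := Polynomial.bernoulli_eval_one_add (p+1) (x:ℚ)
    have h2 : (((x+1 : ℤ)) : ℚ) = 1 + x := by push_cast; ring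
    rw [h2, this]
    simp only [Polynomial.eval_pow, Polynomial.eval_X, intervalIntegral.integral_const_mul, integral_pow]
    push_cast
    field_simp
    ring
  · intro f g _ _ hf hg
    simp only [iterate_map_add, Polynomial.eval_add, mul_add, Finset.sum_add_distrib]
    rw [intervalIntegral.integral_add (f.continuous.intervalIntegrable _ _) (g.continuous.intervalIntegrable _ _), hf, hg]
    ring

/-- classical Euler-Maclaurin summation formula for a polynomial on a lattice
interval `[a₁, a₂]`:
`Σ_{x=a₁}^{a₂} h(x) = ∫_{a₁}^{a₂} h(t) dt − Σ_{n≥1} (b(n)/n!) h^{(n−1)}(a₁)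
  + Σ_{n≥1} (−1)^n (b(n)/n!) h^{(n−1)}(a₂)`,
where `b(n)` is the `n`-th Bernoulli number (with `b(1) = −1/2`); the sums over `n ≥ 1`
are written as sums over `n = m + 1`, `m : ℕ` (only finitely many terms are nonzero). -/
theorem euler_maclaurin_polynomial_interval
    (h : Polynomial ℝ) (a₁ a₂ : ℤ) (hle : a₁ ≤ a₂) :
    ∑ x ∈ Finset.Icc a₁ a₂, h.eval (x : ℝ) =
      (∫ t in (a₁ : ℝ)..(a₂ : ℝ), h.eval t)
        - ∑' m : ℕ, ((bernoulli (m + 1) : ℝ) / (Nat.factorial (m + 1) : ℝ)) *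
            (Polynomial.derivative^[m] h).eval (a₁ : ℝ)
        + ∑' m : ℕ, (-1 : ℝ) ^ (m + 1) * ((bernoulli (m + 1) : ℝ) / (Nat.factorial (m + 1) : ℝ)) *
            (Polynomial.derivative^[m] h).eval (a₂ : ℝ) := by
  have hz : ∀ m ∉ Finset.range (h.natDegree + 1), Polynomial.derivative^[m] h = 0 := fun m hm =>
    Polynomial.iterate_derivative_eq_zero (by simpa using hm)
  rw [tsum_eq_sum (s := Finset.range (h.natDegree + 1)) (fun m hm => by simp [hz m hm]),
    tsum_eq_sum (s := Finset.range (h.natDegree + 1)) (fun m hm => by simp [hz m hm])]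
  have key : ∀ y : ℝ, ∑ m ∈ Finset.range (h.natDegree + 1),
      (-1 : ℝ) ^ (m + 1) * ((bernoulli (m + 1) : ℝ) / (Nat.factorial (m + 1) : ℝ)) *
            (Polynomial.derivative^[m] h).eval y = 
      ∑ m ∈ Finset.range (h.natDegree + 1), ((bernoulli (m + 1) : ℝ) / (Nat.factorial (m + 1) : ℝ)) *
            (Polynomial.derivative^[m] h).eval y + h.eval y := by
    intro y
    rw [Finset.sum_range_succ', Finset.sum_range_succ', add_assoc]
    congr 1
    · refine Finset.sum_congr rfl fun m _ => ?_
      have h1 := bernoulli'_eq_bernoulli (m+1+1)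
      rw [← bernoulli_eq_bernoulli'_of_ne_one (by omega)] at h1
      have h2 : (bernoulli (m+1+1) : ℝ) = (-1)^(m+1+1) * bernoulli (m+1+1) := by exact_mod_cast h1
      rw [← mul_div_assoc, ← h2]
    · norm_num [bernoulli_one]
      ring
  rw [key]
  induction a₂, hle using Int.leInduction with
  | base => simp
  | succ n hn ih =>
    rw [← Finset.insert_Icc_right_eq_Icc_add_one (by omega), Finset.sum_insert (by simp), ih]
    have hI := intervalIntegral.integral_add_adjacent_intervals (μ := MeasureTheory.volume)
      (h.continuous.intervalIntegrable (a₁ : ℝ) n) (h.continuous.intervalIntegrable (n : ℝ) ((n + 1 : ℤ) : ℝ))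
    have := emStep h _ le_rfl n
    linear_combination this + hI
end

section
/- Let η₁,…,η_d be linearly independent vectors in ℤ^d, and let v₁,…,v_d ∈ ℤ^d be primitive lattice vectors satisfying ⟨vᵢ,η_j⟩ = 0 for i ≠ j and q_j := ⟨v_j,η_j⟩ > 0 for each j. Fix 1 ≤ r ≤ d. Then mult(v_{r+1},…,v_d) · ∏_{j=1}^{r} q_j = mult(v₁,…,v_d) · mult(η₁,…,η_r), where for linearly independent lattice vectors w₁,…,wₖ ∈ ℤ^d, mult(w₁,…,wₖ) denotes the index of the subgroup ℤw₁ + … + ℤwₖ in the lattice ℤ^d ∩ span_ℝ(w₁,…,wₖ) (equivalently, the absolute value of the determinant of (w₁,…,wₖ) with respect to a ℤ-basis of ℤ^d ∩ span_ℝ(w₁,…,wₖ)). -/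
open scoped RealInnerProductSpace

/-- The subgroup (`ℤ`-submodule) `ℤ^d ⊆ ℝ^d` of lattice points. -/
def latticeSub (d : ℕ) : Submodule ℤ (EuclideanSpace ℝ (Fin d)) where
  carrier := {x | IsLatticePt x}
  add_mem' := by
    intro a b ha hb j
    obtain ⟨na, hna⟩ := ha j
    obtain ⟨nb, hnb⟩ := hb j
    exact ⟨na + nb, by simp [PiLp.add_apply, hna, hnb]⟩
  zero_mem' := fun j => ⟨0, by simp⟩
  smul_mem' := by
    intro z x hx j
    obtain ⟨n, hn⟩ := hx j
    exact ⟨z * n, by simp [PiLp.smul_apply, hn, zsmul_eq_mul]⟩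

/-- The multiplicity of a family `w₁, …, wₖ` of lattice vectors: the cardinality of the
quotient of the lattice `ℤ^d ∩ span_ℝ(w₁,…,wₖ)` by the subgroup `ℤw₁ + … + ℤwₖ`. -/
noncomputable def latticeMult (d k : ℕ) (w : Fin k → EuclideanSpace ℝ (Fin d)) : ℕ :=
  Nat.card
    ((↥(latticeSub d ⊓ (Submodule.span ℝ (Set.range w)).restrictScalars ℤ)) ⧸
      Submodule.comap
        (latticeSub d ⊓ (Submodule.span ℝ (Set.range w)).restrictScalars ℤ).subtype
        (Submodule.span ℤ (Set.range w)))

open Matrix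

theorem idx_span {E ι : Type*} [AddCommGroup E] [Fintype ι] [DecidableEq ι]
    (b : Module.Basis ι ℤ E) (w : ι → E) (hw : LinearIndependent ℤ w) :
    (Submodule.span ℤ (Set.range w)).toAddSubgroup.index = (b.det w).natAbs := by
  have h := AddSubgroup.index_eq_natAbs_det b (Submodule.span ℤ (Set.range w)).toAddSubgroup
    (Module.Basis.span hw)
  rw [h]
  congr 2
  ext i
  rw [Module.Basis.span_apply hw i]

theorem exists_proj {n β : Type*} [Fintype n] [Finite β] (U : β → n → ℤ) (N : Submodule ℤ (n → ℤ))
    (hN : ∀ x, x ∈ N ↔ ∀ b, U b ⬝ᵥ x = 0) :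
    ∃ π : (n → ℤ) →ₗ[ℤ] N, ∀ x : N, π x = x := by
  classical
  let Ψ : (n → ℤ) →ₗ[ℤ] (β → ℤ) := LinearMap.pi fun b => dotProductBilin ℤ ℤ (U b)
  have hk : N = LinearMap.ker Ψ := by
    ext x; simp [hN, Ψ, LinearMap.mem_ker, funext_iff]
  subst hk
  obtain ⟨s, hs⟩ := Module.projective_lifting_property Ψ.rangeRestrict LinearMap.id
    (LinearMap.surjective_rangeRestrict Ψ)
  have hs' : ∀ y, Ψ (s y) = y := fun y => by
    have := congrArg Subtype.val (LinearMap.congr_fun hs y)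
    simpa using this
  refine ⟨LinearMap.codRestrict _ (LinearMap.id - s ∘ₗ Ψ.rangeRestrict) ?_, ?_⟩
  · intro x
    simp [LinearMap.mem_ker, hs']
  · rintro ⟨x, hx⟩
    ext1
    have : Ψ.rangeRestrict x = 0 := by ext1; simpa using hx
    simp [this]

theorem dot_sum_left {n ι : Type*} [Fintype n] [Fintype ι]
    (V H : ι → n → ℤ) (q : ι → ℤ)
    (hd : ∀ i, V i ⬝ᵥ H i = q i) (ho : ∀ i j, i ≠ j → V i ⬝ᵥ H j = 0) (c : ι → ℤ) (j : ι) :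
    (∑ i, c i • V i) ⬝ᵥ H j = c j * q j := by
  classical
  rw [sum_dotProduct, Finset.sum_eq_single j]
  · rw [smul_dotProduct, hd, smul_eq_mul]
  · intro i _ h; rw [smul_dotProduct, ho i j h, smul_zero]
  · simp

theorem dot_indep {n ι : Type*} [Fintype n] [Fintype ι]
    (V H : ι → n → ℤ) (q : ι → ℤ) (hq : ∀ i, 0 < q i)
    (hd : ∀ i, V i ⬝ᵥ H i = q i) (ho : ∀ i j, i ≠ j → V i ⬝ᵥ H j = 0) :
    LinearIndependent ℤ V := by
  rw [Fintype.linearIndependent_iff]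
  intro c hc j
  have := dot_sum_left V H q hd ho c j
  rw [hc, zero_dotProduct] at this
  have h2 := (hq j).ne'
  simpa [h2] using this.symm

theorem finrank_N {n α β : Type*} [Fintype n] [Fintype α] [Fintype β]
    (V H : α ⊕ β → n → ℤ)
    (ho : ∀ i j, i ≠ j → V i ⬝ᵥ H j = 0)
    (hV : ∀ x, (∀ i, V i ⬝ᵥ x = 0) → x = 0) (N : Submodule ℤ (n → ℤ))
    (hN : ∀ x, x ∈ N ↔ ∀ b, V (Sum.inr b) ⬝ᵥ x = 0)
    (hind : LinearIndependent ℤ (fun a => H (Sum.inl a))) :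
    Module.finrank ℤ N = Fintype.card α := by
  apply le_antisymm
  · let Ψ : N →ₗ[ℤ] (α → ℤ) :=
      (LinearMap.pi fun a => dotProductBilin ℤ ℤ (V (Sum.inl a))) ∘ₗ N.subtype
    have hΨ : Function.Injective Ψ := by
      rw [injective_iff_map_eq_zero]
      rintro ⟨x, hx⟩ h
      ext1
      apply hV
      rintro (a | b)
      · simpa [Ψ] using congrFun h a
      · exact (hN x).1 hx b
    simpa using LinearMap.finrank_le_finrank_of_injective hΨ
  · have hmem : ∀ a, H (Sum.inl a) ∈ N := fun a => (hN _).2 fun b => ho _ _ (by simp)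
    have : LinearIndependent ℤ (fun a => (⟨H (Sum.inl a), hmem a⟩ : N)) :=
      LinearIndependent.of_comp N.subtype hind
    exact this.fintype_card_le_finrank

theorem rangePhi {n α β : Type*} [Fintype n] [Fintype α] [Finite β]
    (U : β → n → ℤ) (h : α → n → ℤ) (N : Submodule ℤ (n → ℤ))
    (hN : ∀ x, x ∈ N ↔ ∀ b, U b ⬝ᵥ x = 0) (hh : ∀ a, h a ∈ N)
    (hind : LinearIndependent ℤ h)
    (hrk : Module.finrank ℤ N = Fintype.card α)
    (Φ : (n → ℤ) →ₗ[ℤ] (α → ℤ)) (hΦ : ∀ x a, Φ x a = x ⬝ᵥ h a) :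
    Φ.toAddMonoidHom.range.index =
      (Submodule.span ℤ (Set.range h)).toAddSubgroup.relIndex N.toAddSubgroup := by
  classical
  let b : Module.Basis α ℤ N := (Module.finBasisOfFinrankEq ℤ N hrk).reindex (Fintype.equivFin α).symm
  let h' : α → N := fun a => ⟨h a, hh a⟩
  have hind' : LinearIndependent ℤ h' := LinearIndependent.of_comp N.subtype hind
  have e1 : (Submodule.span ℤ (Set.range h)).toAddSubgroup.relIndex N.toAddSubgroup
      = (b.det h').natAbs := by
    rw [← idx_span b h' hind', AddSubgroup.relIndex]
    have : (Submodule.span ℤ (Set.range h)).toAddSubgroup.addSubgroupOf N.toAddSubgroup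
      = (Submodule.span ℤ (Set.range h')).toAddSubgroup := by
      have hr : Submodule.span ℤ (Set.range h) = (Submodule.span ℤ (Set.range h')).map N.subtype := by
        rw [Submodule.map_span, ← Set.range_comp]; rfl
      ext ⟨x, hx⟩
      rw [AddSubgroup.mem_addSubgroupOf, Submodule.mem_toAddSubgroup, hr]
      constructor
      · rintro ⟨y, hy, hxy⟩
        have : y = ⟨x, hx⟩ := Subtype.ext hxy
        exact this ▸ hy
      · intro hy; exact ⟨_, hy, rfl⟩
    exact congrArg AddSubgroup.index this
  let A : Matrix α α ℤ := b.toMatrix h'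
  have hA : A.det ≠ 0 := by
    intro h0
    obtain ⟨c, hc, hc0⟩ := Matrix.exists_mulVec_eq_zero_iff.2 h0
    apply hc
    have hz : ∑ a, c a • h' a = 0 := by
      apply b.repr.injective
      ext i
      have := congrFun hc0 i
      simpa [Matrix.mulVec, dotProduct, A, Module.Basis.toMatrix_apply, mul_comm] using this
    funext a
    exact Fintype.linearIndependent_iff.1 hind' c hz a
  have hAr : LinearIndependent ℤ (fun i => A i) := by
    rw [Fintype.linearIndependent_iff]
    intro c hc
    by_contra hne
    apply hA
    refine Matrix.exists_vecMul_eq_zero_iff.1 ⟨c, fun h => hne (by simp [h]), ?_⟩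
    rw [← hc]; ext j; simp [Matrix.vecMul, dotProduct]
  have e2 : Φ.toAddMonoidHom.range = (Submodule.span ℤ (Set.range fun i => A i)).toAddSubgroup := by
    have key : ∀ x, Φ x = ∑ i, (x ⬝ᵥ (b i : n → ℤ)) • A i := by
      intro x
      funext a
      have := congrArg Subtype.val (b.sum_repr (h' a))
      have h2 : h a = ∑ i, A i a • (b i : n → ℤ) := by
        rw [← show ((h' a : N) : n → ℤ) = h a from rfl]
        refine this.symm.trans ?_
        rw [AddSubmonoidClass.coe_finsetSum]
        rfl
      rw [hΦ, h2, dotProduct_sum, Finset.sum_apply]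
      refine Finset.sum_congr rfl fun i _ => ?_
      rw [dotProduct_smul, Pi.smul_apply, smul_eq_mul, smul_eq_mul, mul_comm]
    obtain ⟨π, hπ⟩ := exists_proj U N hN
    ext y
    constructor
    · rintro ⟨x, rfl⟩
      show Φ x ∈ Submodule.span ℤ _
      rw [key]
      exact Submodule.sum_mem _ fun i _ => Submodule.smul_mem _ _ (Submodule.subset_span ⟨i, rfl⟩)
    · intro hy
      obtain ⟨c, rfl⟩ := (Submodule.mem_span_range_iff_exists_fun ℤ).1 hy
      let f : (n → ℤ) →ₗ[ℤ] ℤ := (b.constr ℤ c) ∘ₗ π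
      refine ⟨fun j => f (Pi.single j 1), ?_⟩
      show Φ _ = _
      rw [key]
      have hf : ∀ x, (fun j => f (Pi.single j 1)) ⬝ᵥ x = f x := by
        intro x
        conv_rhs => rw [pi_eq_sum_univ' x, map_sum]
        simp only [dotProduct, map_smul, smul_eq_mul, mul_comm]
        
      refine Finset.sum_congr rfl fun i _ => ?_
      rw [hf]
      simp [f, hπ]
  rw [e1, e2, idx_span (Pi.basisFun ℤ α) _ hAr, Pi.basisFun_det_apply, Module.Basis.det_apply]
  rfl

theorem core {n α β : Type*} [Fintype n] [Fintype α] [Fintype β]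
    (V H : α ⊕ β → n → ℤ) (q : α ⊕ β → ℤ)
    (hq : ∀ i, 0 < q i) (hd : ∀ i, V i ⬝ᵥ H i = q i) (ho : ∀ i j, i ≠ j → V i ⬝ᵥ H j = 0)
    (hV : ∀ x, (∀ i, V i ⬝ᵥ x = 0) → x = 0) (N K : Submodule ℤ (n → ℤ))
    (hN : ∀ x, x ∈ N ↔ ∀ b, V (Sum.inr b) ⬝ᵥ x = 0)
    (hK : ∀ x, x ∈ K ↔ ∀ a, x ⬝ᵥ H (Sum.inl a) = 0) :
    ((Submodule.span ℤ (Set.range fun b => V (Sum.inr b))).toAddSubgroup.relIndex K.toAddSubgroup : ℤ)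
      * ∏ a, q (Sum.inl a) =
    (Submodule.span ℤ (Set.range V)).toAddSubgroup.index *
    (Submodule.span ℤ (Set.range fun a => H (Sum.inl a))).toAddSubgroup.relIndex N.toAddSubgroup := by
  classical
  have hindH : LinearIndependent ℤ H := dot_indep H V q hq
    (fun i => by rw [dotProduct_comm, hd]) (fun i j h => by rw [dotProduct_comm, ho _ _ h.symm])
  have hind : LinearIndependent ℤ (fun a => H (Sum.inl a)) :=
    hindH.comp Sum.inl Sum.inl_injective
  let Φ : (n → ℤ) →ₗ[ℤ] (α → ℤ) :=
    LinearMap.pi fun a => (dotProductBilin ℤ ℤ (H (Sum.inl a)))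
  have hΦ : ∀ x a, Φ x a = x ⬝ᵥ H (Sum.inl a) := fun x a => by simp [Φ, dotProduct_comm]
  have hr := rangePhi (fun b => V (Sum.inr b)) (fun a => H (Sum.inl a)) N hN
    (fun a => (hN _).2 fun b => ho _ _ (by simp)) hind
    (finrank_N V H ho hV N hN hind) Φ hΦ
  rw [← hr]
  have hker : Φ.toAddMonoidHom.ker = K.toAddSubgroup := by
    ext x
    rw [AddMonoidHom.mem_ker, Submodule.mem_toAddSubgroup, hK]
    show Φ x = 0 ↔ _
    simp [funext_iff, hΦ]
  set Z := (Submodule.span ℤ (Set.range V)).toAddSubgroup with hZ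
  have hmap : Z.map Φ.toAddMonoidHom = (Submodule.span ℤ (Set.range fun a : α =>
      (Pi.single a (q (Sum.inl a)) : α → ℤ))).toAddSubgroup := by
    have hs : ∀ c : α ⊕ β → ℤ, Φ (∑ i, c i • V i) = ∑ a, c (Sum.inl a) •
      (Pi.single a (q (Sum.inl a)) : α → ℤ) := by
      intro c
      funext a
      rw [hΦ, dot_sum_left V H q hd ho]
      simp [Finset.sum_apply, Pi.single_apply]
    ext y
    rw [AddSubgroup.mem_map, Submodule.mem_toAddSubgroup, Submodule.mem_span_range_iff_exists_fun]
    constructor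
    · rintro ⟨x, hx, rfl⟩
      obtain ⟨c, rfl⟩ := (Submodule.mem_span_range_iff_exists_fun ℤ).1 hx
      exact ⟨_, (hs c).symm⟩
    · rintro ⟨c, rfl⟩
      refine ⟨_, (Submodule.mem_span_range_iff_exists_fun ℤ).2 ⟨Sum.elim c 0, rfl⟩, ?_⟩
      exact (hs _).trans (by simp)
  have hprod : ((Z.map Φ.toAddMonoidHom).index : ℤ) = ∏ a, q (Sum.inl a) := by
    rw [hmap, idx_span (Pi.basisFun ℤ α), Pi.basisFun_det_apply]
    · have : (Matrix.of fun a : α => (Pi.single a (q (Sum.inl a)) : α → ℤ))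
        = Matrix.diagonal fun a => q (Sum.inl a) := by
        ext i j
        simp [Matrix.diagonal_apply, Pi.single_apply, eq_comm]
      rw [this, Matrix.det_diagonal, Int.natCast_natAbs, abs_of_pos]
      exact Finset.prod_pos fun a _ => hq _
    · rw [Fintype.linearIndependent_iff]
      intro c hc a
      have := congrFun hc a
      have h2 := (hq (Sum.inl a)).ne'
      simpa [Finset.sum_apply, Pi.single_apply, h2] using this
  have hinf : (Submodule.span ℤ (Set.range fun b => V (Sum.inr b))).toAddSubgroup
      = Z ⊓ K.toAddSubgroup := by
    ext x
    rw [AddSubgroup.mem_inf, Submodule.mem_toAddSubgroup, Submodule.mem_toAddSubgroup,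
      Submodule.mem_toAddSubgroup, Submodule.mem_span_range_iff_exists_fun,
      Submodule.mem_span_range_iff_exists_fun, hK]
    constructor
    · rintro ⟨c, rfl⟩
      have e : ∑ i, c i • V (Sum.inr i) = ∑ i, (Sum.elim (0 : α → ℤ) c) i • V i := by
        simp [Fintype.sum_sum_type]
      refine ⟨⟨_, e.symm⟩, fun a => ?_⟩
      rw [e, dot_sum_left V H q hd ho]; simp
    · rintro ⟨⟨c, rfl⟩, h⟩
      refine ⟨fun b => c (Sum.inr b), ?_⟩
      have h0 : ∀ a, c (Sum.inl a) = 0 := fun a => by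
        have := h a
        rw [dot_sum_left V H q hd ho] at this
        have h2 := (hq (Sum.inl a)).ne'
        simpa [h2] using this
      simp [Fintype.sum_sum_type, h0]
  rw [← hprod, hinf, AddSubgroup.inf_relIndex_right, AddSubgroup.index_map, hker,
    ← AddSubgroup.relIndex_mul_index (show Z ≤ Z ⊔ K.toAddSubgroup from le_sup_left),
    AddSubgroup.relIndex_sup_left]
  push_cast
  ring

/-- The embedding of integer vectors in Euclidean space. -/
noncomputable def toE (d : ℕ) : (Fin d → ℤ) →ₗ[ℤ] EuclideanSpace ℝ (Fin d) where
  toFun x := WithLp.toLp 2 fun i => (x i : ℝ)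
  map_add' x y := by ext i; simp
  map_smul' c x := by ext i; simp

theorem toE_apply {d : ℕ} (x : Fin d → ℤ) (i : Fin d) : toE d x i = (x i : ℝ) := rfl

theorem toE_inj (d : ℕ) : Function.Injective (toE d) := by
  intro x y h
  funext i
  have := congrArg (fun z : EuclideanSpace ℝ (Fin d) => z i) h
  simpa [toE_apply] using this

theorem toE_inner {d : ℕ} (x y : Fin d → ℤ) : ⟪toE d x, toE d y⟫ = ((x ⬝ᵥ y : ℤ) : ℝ) := by
  simp [PiLp.inner_apply, toE_apply, dotProduct, mul_comm]

theorem latticeMult_toE {d k : ℕ} (W : Fin k → Fin d → ℤ) (w : Fin k → EuclideanSpace ℝ (Fin d))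
    (hw : ∀ i, w i = toE d (W i)) (K : Submodule ℤ (Fin d → ℤ))
    (hK : ∀ x, x ∈ K ↔ toE d x ∈ Submodule.span ℝ (Set.range w)) :
    latticeMult d k w =
      (Submodule.span ℤ (Set.range W)).toAddSubgroup.relIndex K.toAddSubgroup := by
  have h1 : latticeMult d k w = (Submodule.span ℤ (Set.range w)).toAddSubgroup.relIndex
      (latticeSub d ⊓ (Submodule.span ℝ (Set.range w)).restrictScalars ℤ).toAddSubgroup := rfl
  have h2 : (Submodule.span ℤ (Set.range w)).toAddSubgroup =
      (Submodule.span ℤ (Set.range W)).toAddSubgroup.map (toE d).toAddMonoidHom := by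
    have : Submodule.span ℤ (Set.range w) = (Submodule.span ℤ (Set.range W)).map (toE d) := by
      rw [Submodule.map_span, ← Set.range_comp]
      congr 2
      funext i; exact hw i
    rw [this]; rfl
  have h3 : (latticeSub d ⊓ (Submodule.span ℝ (Set.range w)).restrictScalars ℤ).toAddSubgroup
      = K.toAddSubgroup.map (toE d).toAddMonoidHom := by
    ext x
    constructor
    · rintro ⟨hx, hx'⟩
      choose y hy using hx
      have : x = toE d y := by ext i; rw [hy, toE_apply]
      subst this
      exact ⟨y, (hK y).2 hx', rfl⟩
    · rintro ⟨y, hy, rfl⟩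
      exact ⟨fun i => ⟨y i, rfl⟩, (hK y).1 hy⟩
  rw [h1, h2, h3, AddSubgroup.relIndex_map_map_of_injective _ _ (toE_inj d)]

theorem mem_span_biorth {d : ℕ} {κ : Type*} (a b : Fin d → EuclideanSpace ℝ (Fin d))
    (ho : ∀ i j, i ≠ j → ⟪a i, b j⟫ = 0) (hd : ∀ i, 0 < ⟪a i, b i⟫) (s : κ → Fin d)
    (x : EuclideanSpace ℝ (Fin d)) :
    x ∈ Submodule.span ℝ (Set.range fun k => a (s k)) ↔
      ∀ j, (∀ k, s k ≠ j) → ⟪x, b j⟫ = 0 := by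
  have hs : ∀ (c : Fin d → ℝ) j, ⟪∑ i, c i • a i, b j⟫ = c j * ⟪a j, b j⟫ := by
    intro c j
    rw [sum_inner, Finset.sum_eq_single j]
    · simp [inner_smul_left]
    · intro i _ h; simp [inner_smul_left, ho i j h]
    · simp
  have hind : LinearIndependent ℝ a := by
    rw [Fintype.linearIndependent_iff]
    intro c hc j
    have := hs c j
    rw [hc, inner_zero_left] at this
    simpa [(hd j).ne'] using this.symm
  have hspan : Submodule.span ℝ (Set.range a) = ⊤ :=
    hind.span_eq_top_of_card_eq_finrank' (by simp)
  constructor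
  · intro hx j hj
    induction hx using Submodule.span_induction with
    | mem x hx => obtain ⟨k, rfl⟩ := hx; exact ho _ _ (hj k)
    | zero => simp
    | add x y _ _ h1 h2 => rw [inner_add_left, h1, h2, add_zero]
    | smul c x _ h => simp [inner_smul_left, h]
  · intro h
    have hx : x ∈ Submodule.span ℝ (Set.range a) := hspan ▸ Submodule.mem_top
    obtain ⟨c, rfl⟩ := (Submodule.mem_span_range_iff_exists_fun ℝ).1 hx
    refine Submodule.sum_mem _ fun i _ => ?_
    by_cases hi : ∃ k, s k = i
    · obtain ⟨k, rfl⟩ := hi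
      exact Submodule.smul_mem _ _ (Submodule.subset_span ⟨k, rfl⟩)
    · push Not at hi
      have := h i hi
      rw [hs] at this
      have hc : c i = 0 := by simpa [(hd i).ne'] using this
      simp [hc]


/-- Lemma `check`: with `η₁,…,η_d` linearly independent lattice vectors,
`v₁,…,v_d` primitive lattice vectors with `⟨vᵢ,η_j⟩ = 0` for `i ≠ j` and
`q_j = ⟨v_j,η_j⟩ > 0`, for `1 ≤ r ≤ d` one has
`mult(v_{r+1},…,v_d) · ∏_{j≤r} q_j = mult(v₁,…,v_d) · mult(η₁,…,η_r)`. -/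
theorem mult_facet_eq_mult_mul_mult
    (d : ℕ) (η v : Fin d → EuclideanSpace ℝ (Fin d))
    (hη : ∀ i, IsLatticePt (η i))
    (hηindep : LinearIndependent ℝ η)
    (hv : ∀ i, IsPrimitive (v i))
    (horth : ∀ i j, i ≠ j → ⟪v i, η j⟫ = 0)
    (q : Fin d → ℝ)
    (hq : ∀ j, q j = ⟪v j, η j⟫)
    (hqpos : ∀ j, 0 < q j)
    (r : ℕ) (hr1 : 1 ≤ r) (hrd : r ≤ d) :
    (latticeMult d (d - r) (fun i => v ⟨r + (i : ℕ), by have := i.isLt; omega⟩) : ℝ) *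
        ∏ j : Fin r, q ⟨(j : ℕ), by have := j.isLt; omega⟩ =
      (latticeMult d d v : ℝ) *
        (latticeMult d r (fun i => η ⟨(i : ℕ), by have := i.isLt; omega⟩) : ℝ) := by
  choose H hH using hη
  choose V hV using fun i => (hv i).1
  have eH : ∀ i, η i = toE d (H i) := fun i => by ext j; rw [hH, toE_apply]
  have eV : ∀ i, v i = toE d (V i) := fun i => by ext j; rw [hV, toE_apply]
  have ho : ∀ i j, i ≠ j → V i ⬝ᵥ H j = 0 := fun i j h => by
    have := horth i j h
    rw [eH, eV, toE_inner] at this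
    exact_mod_cast this
  have hqq : ∀ j, q j = ((V j ⬝ᵥ H j : ℤ) : ℝ) := fun j => by rw [hq, eH, eV, toE_inner]
  have hpos : ∀ j, 0 < V j ⬝ᵥ H j := fun j => by
    have := hqpos j
    rw [hqq] at this
    exact_mod_cast this
  have hpos' : ∀ j, 0 < ⟪v j, η j⟫ := fun j => hq j ▸ hqpos j
  have hpos'' : ∀ j, 0 < ⟪η j, v j⟫ := fun j => by rw [real_inner_comm]; exact hpos' j
  have horth' : ∀ i j, i ≠ j → ⟪η i, v j⟫ = 0 := fun i j h => by
    rw [real_inner_comm]; exact horth j i h.symm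
  let e : Fin r ⊕ Fin (d - r) ≃ Fin d := finSumFinEquiv.trans (finCongr (by omega))
  have el : ∀ i : Fin r, e (Sum.inl i) = ⟨i, by have := i.isLt; omega⟩ := fun i => by
    ext; simp [e]
  have er : ∀ i : Fin (d - r), e (Sum.inr i) = ⟨r + i, by have := i.isLt; omega⟩ := fun i => by
    ext; simp [e]
  let N : Submodule ℤ (Fin d → ℤ) := ((Submodule.span ℝ
    (Set.range fun k => η (e (Sum.inl k)))).restrictScalars ℤ).comap (toE d)
  let K : Submodule ℤ (Fin d → ℤ) := ((Submodule.span ℝ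
    (Set.range fun k => v (e (Sum.inr k)))).restrictScalars ℤ).comap (toE d)
  have hN : ∀ x, x ∈ N ↔ ∀ b, V (e (Sum.inr b)) ⬝ᵥ x = 0 := by
    intro x
    have h := mem_span_biorth η v horth' hpos'' (fun k => e (Sum.inl k)) (toE d x)
    refine Iff.trans h ?_
    rw [← e.forall_congr_right, Sum.forall]
    simp [eV, toE_inner, dotProduct_comm x]
  have hK : ∀ x, x ∈ K ↔ ∀ a, x ⬝ᵥ H (e (Sum.inl a)) = 0 := by
    intro x
    have h := mem_span_biorth v η horth hpos' (fun k => e (Sum.inr k)) (toE d x)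
    refine Iff.trans h ?_
    rw [← e.forall_congr_right, Sum.forall]
    simp [eH, toE_inner]
  have htop : ∀ x : Fin d → ℤ, x ∈ (⊤ : Submodule ℤ (Fin d → ℤ)) ↔
      toE d x ∈ Submodule.span ℝ (Set.range v) := by
    intro x
    have h := mem_span_biorth v η horth hpos' (fun k => k) (toE d x)
    simp only [Submodule.mem_top, true_iff]
    exact h.2 fun j hj => absurd rfl (hj j)
  have hVinj : ∀ x, (∀ i, V (e i) ⬝ᵥ x = 0) → x = 0 := by
    intro x hx
    have h := (mem_span_biorth η v horth' hpos'' (fun k : Empty => k.elim) (toE d x)).2 (by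
      intro j _
      obtain ⟨i, rfl⟩ := e.surjective j
      rw [eV, toE_inner, dotProduct_comm, hx i]; simp)
    apply toE_inj d
    rw [Set.range_eq_empty, Submodule.span_empty, Submodule.mem_bot] at h
    rw [h, map_zero]
  have hc := core (fun i => V (e i)) (fun i => H (e i)) (fun i => V (e i) ⬝ᵥ H (e i))
    (fun i => hpos _) (fun i => rfl) (fun i j h => ho _ _ (e.injective.ne h)) hVinj N K hN hK
  have hrange : Set.range (fun i => V (e i)) = Set.range V := e.surjective.range_comp V
  rw [hrange] at hc
  have m1 := latticeMult_toE (fun b => V (e (Sum.inr b))) (fun b => v (e (Sum.inr b)))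
    (fun i => eV _) K (fun x => Iff.rfl)
  have m2 := latticeMult_toE (fun b => H (e (Sum.inl b))) (fun b => η (e (Sum.inl b)))
    (fun i => eH _) N (fun x => Iff.rfl)
  have m3 := latticeMult_toE V v eV ⊤ htop
  rw [Submodule.top_toAddSubgroup, AddSubgroup.relIndex_top_right] at m3
  rw [← m1, ← m2, ← m3] at hc
  simp only [el, er] at hc
  simp only [hqq]
  exact_mod_cast hc
end

section
/- Let C be a pointed polyhedral cone in ℝ^d with lin(C) = ℝ^d, and let C* be its dual cone (which is then also pointed and full-dimensional). Then the map σ ↦ C* ∩ lin(σ)^⊥ is an inclusion-reversing bijection from the set of faces of C onto the set of faces of C*, and for every face σ of C one has dim(C* ∩ lin(σ)^⊥) = d − dim σ. -/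
open scoped RealInnerProductSpace

section helpers

variable {d k : ℕ} {v : Fin k → EuclideanSpace ℝ (Fin d)} {C : Set (EuclideanSpace ℝ (Fin d))}

theorem gen_mem (hC : C = {x | ∃ t : Fin k → ℝ, (∀ i, 0 ≤ t i) ∧ x = ∑ i, t i • v i})
    (i : Fin k) : v i ∈ C := by
  classical
  rw [hC]
  refine ⟨Pi.single i 1, fun j => ?_, ?_⟩
  · by_cases h : j = i
    · subst h; simp
    · simp [h]
  · simp [Pi.single_apply, ite_smul]

theorem cone_add (hC : C = {x | ∃ t : Fin k → ℝ, (∀ i, 0 ≤ t i) ∧ x = ∑ i, t i • v i})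
    {x y : EuclideanSpace ℝ (Fin d)} (hx : x ∈ C) (hy : y ∈ C) : x + y ∈ C := by
  rw [hC] at *
  obtain ⟨s, hs, rfl⟩ := hx
  obtain ⟨t, ht, rfl⟩ := hy
  exact ⟨fun i => s i + t i, fun i => add_nonneg (hs i) (ht i), by
    simp [add_smul, Finset.sum_add_distrib]⟩

theorem cone_smul (hC : C = {x | ∃ t : Fin k → ℝ, (∀ i, 0 ≤ t i) ∧ x = ∑ i, t i • v i})
    {x : EuclideanSpace ℝ (Fin d)} (hx : x ∈ C) {a : ℝ} (ha : 0 ≤ a) : a • x ∈ C := by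
  rw [hC] at *
  obtain ⟨s, hs, rfl⟩ := hx
  exact ⟨fun i => a * s i, fun i => mul_nonneg ha (hs i), by
    simp [mul_smul, Finset.smul_sum]⟩

theorem mem_dual_gen (hC : C = {x | ∃ t : Fin k → ℝ, (∀ i, 0 ≤ t i) ∧ x = ∑ i, t i • v i})
    {ξ : EuclideanSpace ℝ (Fin d)} : ξ ∈ dualSet C ↔ ∀ i, 0 ≤ ⟪ξ, v i⟫ := by
  constructor
  · intro h i
    exact h _ (gen_mem hC i)
  · intro h x hx
    rw [hC] at hx
    obtain ⟨t, ht, rfl⟩ := hx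
    rw [inner_sum]
    refine Finset.sum_nonneg fun i _ => ?_
    rw [inner_smul_right]
    exact mul_nonneg (ht i) (h i)

theorem sum_inner_zero {ξ : EuclideanSpace ℝ (Fin d)} (hξ : ∀ i, 0 ≤ ⟪ξ, v i⟫)
    {t : Fin k → ℝ} (ht : ∀ i, 0 ≤ t i) (h : ⟪ξ, ∑ i, t i • v i⟫ = 0) (i : Fin k) :
    t i = 0 ∨ ⟪ξ, v i⟫ = 0 := by
  rw [inner_sum] at h
  have := (Finset.sum_eq_zero_iff_of_nonneg (fun i _ => by
    rw [inner_smul_right]; exact mul_nonneg (ht i) (hξ i))).1 h i (Finset.mem_univ i)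
  rw [inner_smul_right] at this
  exact mul_eq_zero.1 this

/-- A functional vanishing on generators killed by `ξ` vanishes on the face cut out by `ξ`. -/
theorem vanish_face (hC : C = {x | ∃ t : Fin k → ℝ, (∀ i, 0 ≤ t i) ∧ x = ∑ i, t i • v i})
    {ξ η : EuclideanSpace ℝ (Fin d)} (hξ : ξ ∈ dualSet C)
    (hη : ∀ i, ⟪ξ, v i⟫ = 0 → ⟪η, v i⟫ = 0) {x : EuclideanSpace ℝ (Fin d)} (hx : x ∈ C)
    (h : ⟪ξ, x⟫ = 0) : ⟪η, x⟫ = 0 := by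
  rw [mem_dual_gen hC] at hξ
  rw [hC] at hx
  obtain ⟨t, ht, rfl⟩ := hx
  rw [inner_sum]
  refine Finset.sum_eq_zero fun i _ => ?_
  rw [inner_smul_right]
  rcases sum_inner_zero hξ ht h i with h0 | h0
  · simp [h0]
  · simp [hη i h0]

theorem eps_dual (hC : C = {x | ∃ t : Fin k → ℝ, (∀ i, 0 ≤ t i) ∧ x = ∑ i, t i • v i})
    {ξ η : EuclideanSpace ℝ (Fin d)} (hξ : ξ ∈ dualSet C)
    (hη : ∀ i, ⟪ξ, v i⟫ = 0 → ⟪η, v i⟫ = 0) :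
    ∃ ε : ℝ, 0 < ε ∧ ξ + ε • η ∈ dualSet C := by
  have hξ' := (mem_dual_gen hC).1 hξ
  have key : ∀ᶠ ε : ℝ in nhdsWithin 0 (Set.Ioi 0), ∀ i, 0 ≤ ⟪ξ, v i⟫ + ε * ⟪η, v i⟫ := by
    rw [Filter.eventually_all]
    intro i
    rcases (hξ' i).eq_or_lt with h | h
    · simp [← h, hη i h.symm]
    · apply Filter.Eventually.filter_mono nhdsWithin_le_nhds
      have hc : Continuous fun ε : ℝ => ⟪ξ, v i⟫ + ε * ⟪η, v i⟫ := by fun_prop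
      have := hc.continuousAt (x := 0) |>.eventually (lt_mem_nhds (a := 0) (by simpa using h))
      exact this.mono fun _ h => le_of_lt h
  obtain ⟨ε, h1, h2⟩ := (key.and self_mem_nhdsWithin).exists
  refine ⟨ε, h2, (mem_dual_gen hC).2 fun i => ?_⟩
  rw [inner_add_left, real_inner_smul_left]
  exact h1 i

theorem orth_span {σ : Set (EuclideanSpace ℝ (Fin d))} {ξ : EuclideanSpace ℝ (Fin d)} :
    (∀ x ∈ Submodule.span ℝ σ, ⟪ξ, x⟫ = 0) ↔ ∀ x ∈ σ, ⟪ξ, x⟫ = 0 := by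
  constructor
  · exact fun h x hx => h x (Submodule.subset_span hx)
  · intro h x hx
    induction hx using Submodule.span_induction with
    | mem x hx => exact h x hx
    | zero => simp
    | add x y _ _ hx hy => simp [inner_add_right, hx, hy]
    | smul a x _ hx => simp [inner_smul_right, hx]

theorem span_dual_face
    (hC : C = {x | ∃ t : Fin k → ℝ, (∀ i, 0 ≤ t i) ∧ x = ∑ i, t i • v i})
    {σ : Set (EuclideanSpace ℝ (Fin d))} (hσ : IsFaceOf C σ) :
    Submodule.span ℝ (dualSet C ∩ {ξ | ∀ x ∈ σ, ⟪ξ, x⟫ = 0}) = (Submodule.span ℝ σ)ᗮ := by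
  obtain ⟨ξ, hξ, rfl⟩ := hσ
  apply le_antisymm
  · rw [Submodule.span_le]
    rintro η ⟨_, h2⟩
    rw [SetLike.mem_coe, Submodule.mem_orthogonal']
    exact orth_span.2 h2
  · intro η hη
    rw [Submodule.mem_orthogonal'] at hη
    have hη := orth_span.1 hη
    obtain ⟨ε, hε, h⟩ := eps_dual hC (η := η) hξ fun i hi => hη _ ⟨gen_mem hC i, hi⟩
    have h1 : ξ ∈ Submodule.span ℝ
        (dualSet C ∩ {ζ | ∀ x ∈ {x ∈ C | ⟪ξ, x⟫ = 0}, ⟪ζ, x⟫ = 0}) :=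
      Submodule.subset_span ⟨hξ, fun x hx => hx.2⟩
    have h2 : ξ + ε • η ∈ Submodule.span ℝ
        (dualSet C ∩ {ζ | ∀ x ∈ {x ∈ C | ⟪ξ, x⟫ = 0}, ⟪ζ, x⟫ = 0}) :=
      Submodule.subset_span ⟨h, fun x hx => by
        rw [inner_add_left, real_inner_smul_left, hx.2, hη x hx]; simp⟩
    have h3 := Submodule.smul_mem _ ε⁻¹ (Submodule.sub_mem _ h2 h1)
    rwa [add_sub_cancel_left, smul_smul, inv_mul_cancel₀ hε.ne', one_smul] at h3

theorem zero_face
    (hC : C = {x | ∃ t : Fin k → ℝ, (∀ i, 0 ≤ t i) ∧ x = ∑ i, t i • v i})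
    (hpointed : C ∩ (-C) = {0}) : IsFaceOf C {0} := by
  have hsub : convexHull ℝ {x | (∃ i, v i = x) ∧ x ≠ 0} ⊆ {x | x ∈ C ∧ x ≠ 0} := by
    apply convexHull_min
    · rintro x ⟨⟨i, rfl⟩, h⟩
      exact ⟨gen_mem hC i, h⟩
    · rintro x ⟨hx, hx0⟩ y ⟨hy, hy0⟩ a b ha hb hab
      refine ⟨cone_add hC (cone_smul hC hx ha) (cone_smul hC hy hb), fun h0 => ?_⟩
      have hax : a • x ∈ C ∩ (-C) := by
        refine ⟨cone_smul hC hx ha, ?_⟩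
        rw [Set.mem_neg, neg_eq_of_add_eq_zero_right h0]
        exact cone_smul hC hy hb
      rw [hpointed, Set.mem_singleton_iff] at hax
      have ha0 : a = 0 := (smul_eq_zero.1 hax).resolve_right hx0
      subst ha0
      have : b = 1 := by linarith
      subst this
      simp at h0
      exact hy0 h0
  have hfin : {x | (∃ i, v i = x) ∧ x ≠ 0}.Finite :=
    (Set.finite_range v).subset fun x hx => hx.1
  have hcl : IsClosed (convexHull ℝ {x | (∃ i, v i = x) ∧ x ≠ 0}) :=
    hfin.isClosed_convexHull ℝ
  obtain ⟨f, u, hu, hf⟩ := geometric_hahn_banach_point_closed (convex_convexHull ℝ _) hcl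
    (fun h => (hsub h).2 rfl : (0 : EuclideanSpace ℝ (Fin d)) ∉ _)
  have hpos : ∀ i, v i ≠ 0 → 0 < ⟪(InnerProductSpace.toDual ℝ _).symm f, v i⟫ := by
    intro i hi
    rw [InnerProductSpace.toDual_symm_apply]
    have := hf _ (subset_convexHull ℝ _ ⟨⟨i, rfl⟩, hi⟩)
    simp at hu
    linarith
  have hnn : ∀ i, 0 ≤ ⟪(InnerProductSpace.toDual ℝ _).symm f, v i⟫ := by
    intro i
    by_cases h : v i = 0
    · simp [h]
    · exact (hpos i h).le
  refine ⟨_, (mem_dual_gen hC).2 hnn, ?_⟩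
  ext x
  constructor
  · rintro rfl
    refine ⟨?_, by simp⟩
    have : (0 : EuclideanSpace ℝ (Fin d)) ∈ C ∩ (-C) := by rw [hpointed]; rfl
    exact this.1
  · rintro ⟨hx, h0⟩
    rw [hC] at hx
    obtain ⟨t, ht, rfl⟩ := hx
    rw [Set.mem_singleton_iff]
    refine Finset.sum_eq_zero fun i _ => ?_
    rcases sum_inner_zero hnn ht h0 i with h | h
    · simp [h]
    · by_cases hv : v i = 0
      · simp [hv]
      · exact absurd h (hpos i hv).ne'

theorem image_face
    (hC : C = {x | ∃ t : Fin k → ℝ, (∀ i, 0 ≤ t i) ∧ x = ∑ i, t i • v i})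
    {σ : Set (EuclideanSpace ℝ (Fin d))} (hσ : IsFaceOf C σ) :
    IsFaceOf (dualSet C) (dualSet C ∩ {ξ | ∀ x ∈ σ, ⟪ξ, x⟫ = 0}) := by
  classical
  obtain ⟨ξ, hξ, rfl⟩ := hσ
  have key : ∀ η : EuclideanSpace ℝ (Fin d),
      ⟪∑ i with ⟪ξ, v i⟫ = 0, v i, η⟫ = ∑ i with ⟪ξ, v i⟫ = 0, ⟪η, v i⟫ := fun η => by
    rw [sum_inner]
    exact Finset.sum_congr rfl fun i _ => real_inner_comm _ _
  refine ⟨∑ i with ⟪ξ, v i⟫ = 0, v i, fun η hη => ?_, ?_⟩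
  · rw [key]
    exact Finset.sum_nonneg fun i _ => hη _ (gen_mem hC i)
  · ext η
    constructor
    · rintro ⟨h1, h2⟩
      refine ⟨h1, ?_⟩
      rw [key]
      refine Finset.sum_eq_zero fun i hi => h2 _ ⟨gen_mem hC i, ?_⟩
      simpa using hi
    · rintro ⟨h1, h2⟩
      refine ⟨h1, fun x hx => ?_⟩
      rw [key, Finset.sum_eq_zero_iff_of_nonneg fun i _ => h1 _ (gen_mem hC i)] at h2
      exact vanish_face hC hξ (fun i hi => h2 i (by simpa using hi)) hx.1 hx.2

theorem surj_face
    (hC : C = {x | ∃ t : Fin k → ℝ, (∀ i, 0 ≤ t i) ∧ x = ∑ i, t i • v i})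
    {G : Set (EuclideanSpace ℝ (Fin d))} (hG : IsFaceOf (dualSet C) G) :
    ∃ σ, IsFaceOf C σ ∧ dualSet C ∩ {ξ | ∀ x ∈ σ, ⟪ξ, x⟫ = 0} = G := by
  classical
  obtain ⟨x, hx, rfl⟩ := hG
  have hg : ∀ i, ∃ g, (g ∈ dualSet C ∧ ⟪x, g⟫ = 0) ∧
      (⟪g, v i⟫ = 0 → ∀ h, h ∈ dualSet C → ⟪x, h⟫ = 0 → ⟪h, v i⟫ = 0) := by
    intro i
    by_cases H : ∀ h, h ∈ dualSet C → ⟪x, h⟫ = 0 → ⟪h, v i⟫ = 0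
    · exact ⟨0, ⟨fun y _ => by simp, by simp⟩, fun _ => H⟩
    · push Not at H
      obtain ⟨h, h1, h2, h3⟩ := H
      exact ⟨h, ⟨h1, h2⟩, fun h0 => absurd h0 h3⟩
  choose g hg hg' using hg
  have hξ : ∑ i, g i ∈ dualSet C := fun y hy => by
    rw [sum_inner]
    exact Finset.sum_nonneg fun i _ => (hg i).1 y hy
  have hxξ : ⟪x, ∑ i, g i⟫ = 0 := by
    rw [inner_sum]
    exact Finset.sum_eq_zero fun i _ => (hg i).2
  have hv : ∀ i, ⟪∑ j, g j, v i⟫ = 0 → ∀ h, h ∈ dualSet C → ⟪x, h⟫ = 0 → ⟪h, v i⟫ = 0 := by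
    intro i hi
    rw [sum_inner, Finset.sum_eq_zero_iff_of_nonneg
      fun j _ => (hg j).1 _ (gen_mem hC i)] at hi
    exact hg' i (hi i (Finset.mem_univ i))
  refine ⟨_, ⟨∑ i, g i, hξ, rfl⟩, ?_⟩
  ext η
  constructor
  · rintro ⟨h1, h2⟩
    refine ⟨h1, ?_⟩
    obtain ⟨ε, hε, h⟩ := eps_dual hC (η := -η) hξ fun i hi => by
      rw [inner_neg_left, h2 _ ⟨gen_mem hC i, hi⟩, neg_zero]
    have h3 := hx _ h
    rw [inner_add_right, hxξ, inner_smul_right, inner_neg_right] at h3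
    have h4 := hx _ h1
    nlinarith
  · rintro ⟨h1, h2⟩
    exact ⟨h1, fun y hy => vanish_face hC hξ (fun i hi => hv i hi η h1 h2) hy.1 hy.2⟩

theorem face_sub
    (hC : C = {x | ∃ t : Fin k → ℝ, (∀ i, 0 ≤ t i) ∧ x = ∑ i, t i • v i})
    {σ₁ σ₂ : Set (EuclideanSpace ℝ (Fin d))} (h₁ : IsFaceOf C σ₁) (h₂ : IsFaceOf C σ₂)
    (h : dualSet C ∩ {ξ | ∀ x ∈ σ₂, ⟪ξ, x⟫ = 0} ⊆ dualSet C ∩ {ξ | ∀ x ∈ σ₁, ⟪ξ, x⟫ = 0}) :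
    σ₁ ⊆ σ₂ := by
  obtain ⟨ξ₁, hξ₁, rfl⟩ := h₁
  obtain ⟨ξ₂, hξ₂, rfl⟩ := h₂
  intro x hx
  exact ⟨hx.1, (h ⟨hξ₂, fun y hy => hy.2⟩).2 x hx⟩

end helpers

/-- for a pointed full-dimensional polyhedral cone `C` in `ℝ^d`, the dual cone
`C*` is also pointed and full-dimensional, and `σ ↦ C* ∩ lin(σ)^⊥` is an inclusion-reversing
bijection from the faces of `C` onto the faces of `C*`, with
`dim (C* ∩ lin(σ)^⊥) = d − dim σ`. -/
theorem dual_cone_face_correspondence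
    (d k : ℕ) (v : Fin k → EuclideanSpace ℝ (Fin d))
    (C : Set (EuclideanSpace ℝ (Fin d)))
    (hC : C = {x | ∃ t : Fin k → ℝ, (∀ i, 0 ≤ t i) ∧ x = ∑ i, t i • v i})
    (hpointed : C ∩ (-C) = {0})
    (hfull : Submodule.span ℝ C = ⊤)
    (Φ : Set (EuclideanSpace ℝ (Fin d)) → Set (EuclideanSpace ℝ (Fin d)))
    (hΦ : ∀ σ, Φ σ = dualSet C ∩ {ξ | ∀ x ∈ Submodule.span ℝ σ, ⟪ξ, x⟫ = 0}) :
    (dualSet C ∩ (-dualSet C) = {0}) ∧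
    (Submodule.span ℝ (dualSet C) = ⊤) ∧
    (∀ σ, IsFaceOf C σ → IsFaceOf (dualSet C) (Φ σ)) ∧
    (∀ σ₁ σ₂, IsFaceOf C σ₁ → IsFaceOf C σ₂ → Φ σ₁ = Φ σ₂ → σ₁ = σ₂) ∧
    (∀ G, IsFaceOf (dualSet C) G → ∃ σ, IsFaceOf C σ ∧ Φ σ = G) ∧
    (∀ σ₁ σ₂, IsFaceOf C σ₁ → IsFaceOf C σ₂ → (σ₁ ⊆ σ₂ ↔ Φ σ₂ ⊆ Φ σ₁)) ∧
    (∀ σ, IsFaceOf C σ →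
      Module.finrank ℝ (Submodule.span ℝ (Φ σ)) =
        d - Module.finrank ℝ (Submodule.span ℝ σ)) := by
  have hΦ' : ∀ σ, Φ σ = dualSet C ∩ {ξ | ∀ x ∈ σ, ⟪ξ, x⟫ = 0} := fun σ => by
    rw [hΦ]
    congr 1
    ext ξ
    exact orth_span
  refine ⟨?_, ?_, ?_, ?_, ?_, ?_, ?_⟩
  · ext ξ
    constructor
    · rintro ⟨h1, h2⟩
      have h0 : ∀ x ∈ C, ⟪ξ, x⟫ = 0 := fun x hx => by
        have h3 := h2 x hx
        rw [inner_neg_left] at h3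
        linarith [h1 x hx]
      have := orth_span.2 h0 ξ (by rw [hfull]; trivial)
      exact inner_self_eq_zero.1 this
    · rintro rfl
      refine ⟨fun x _ => by simp, ?_⟩
      rw [Set.mem_neg, neg_zero]
      exact fun x _ => by simp
  · have := span_dual_face hC (zero_face hC hpointed)
    rw [eq_top_iff]
    simp only [Submodule.span_zero_singleton, Submodule.bot_orthogonal_eq_top] at this
    rw [← this]
    exact Submodule.span_mono Set.inter_subset_left
  · intro σ hσ
    rw [hΦ']
    exact image_face hC hσ
  · intro σ₁ σ₂ h₁ h₂ h
    rw [hΦ', hΦ'] at h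
    exact (face_sub hC h₁ h₂ h.ge).antisymm (face_sub hC h₂ h₁ h.le)
  · intro G hG
    obtain ⟨σ, h1, h2⟩ := surj_face hC hG
    exact ⟨σ, h1, by rw [hΦ', h2]⟩
  · intro σ₁ σ₂ h₁ h₂
    rw [hΦ', hΦ']
    exact ⟨fun h ξ hξ => ⟨hξ.1, fun x hx => hξ.2 x (h hx)⟩, face_sub hC h₁ h₂⟩
  · intro σ hσ
    rw [hΦ', span_dual_face hC hσ]
    have := Submodule.finrank_add_finrank_orthogonal (Submodule.span ℝ σ)
    rw [finrank_euclideanSpace_fin] at this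
    omega
end
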